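/- Let c>0, let c_1,…,c_N>0 be fixed, let 1≤κ≤2 and μ>0. Then there exists a constant C>0, depending only on κ, μ, c and c_1,…,c_N, such that the following holds: if G:[0,∞)×ℝ³→ℝ is smooth and u is a smooth solution of ∂_t²u−c²Δ_x u=G on (0,∞)×ℝ³ with u(0,·)=0 and ∂_t u(0,·)=0, then for every t>0 and every x∈ℝ³ with x≠0, ⟨|x|⟩·⟨t+|x|⟩·⟨ct−|x|⟩^{κ−1}·(log(2+t+|x|))^{−1}·|D_{+,c}u(t,x)| ≤ C·A_{κ,μ,2}[G;c](t,x). -/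

import Mathlib

noncomputable section

namespace PaperKatayama

/-- Euclidean 3-space. -/
abbrev E3 := EuclideanSpace ℝ (Fin 3)

/-- Space-time functions. -/
abbrev Fn := ℝ → E3 → ℝ

/-- Functions of the space variable alone. -/
abbrev SFn := E3 → ℝ

/-- The Japanese bracket `⟨a⟩ = √(1+a²)`. -/
def jb (a : ℝ) : ℝ := Real.sqrt (1 + a ^ 2)

/-- Time derivative `∂_t`. -/
def pt (f : Fn) : Fn := fun t x => deriv (fun s => f s x) t

/-- Spatial derivative `∂_j` (j = 1,2,3, here indexed by `Fin 3`). -/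
def pd (j : Fin 3) (f : Fn) : Fn :=
  fun t x => fderiv ℝ (f t) x (EuclideanSpace.single j 1)

/-- `∂_a` for `a ∈ {0,1,2,3}`, with `∂_0 = ∂_t`. -/
def pda (a : Fin 4) : Fn → Fn := Fin.cases pt (fun j => pd j) a

/-- Rotation field `Ω_{jk} = x_j ∂_k − x_k ∂_j`, extended antisymmetrically
(so `rotA k j = − rotA j k`, and `rotA j j = 0`). -/
def rotA (j k : Fin 3) (f : Fn) : Fn :=
  fun t x => x j * pd k f t x - x k * pd j f t x

/-- Radial derivative `∂_r = Σ_j (x_j/r) ∂_j`. -/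
def pr (f : Fn) : Fn := fun t x => ∑ j, (x j / ‖x‖) * pd j f t x

/-- `D_{+,c} = ∂_t + c ∂_r`. -/
def Dp (c : ℝ) (f : Fn) : Fn := fun t x => pt f t x + c * pr f t x

/-- `D_{−,c} = ∂_t − c ∂_r`. -/
def Dm (c : ℝ) (f : Fn) : Fn := fun t x => pt f t x - c * pr f t x

/-- The seven fields `Z = {∂_t, ∂_1, ∂_2, ∂_3, Ω_{12}, Ω_{13}, Ω_{23}}`. -/
def Zop : Fin 7 → Fn → Fn :=
  ![pt, pd 0, pd 1, pd 2, rotA 0 1, rotA 0 2, rotA 1 2]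

/-- `Z^α = Z_1^{α_1} ⋯ Z_7^{α_7}`. -/
def Zpow (α : Fin 7 → ℕ) (f : Fn) : Fn :=
  (Zop 0)^[α 0] <| (Zop 1)^[α 1] <| (Zop 2)^[α 2] <| (Zop 3)^[α 3] <|
    (Zop 4)^[α 4] <| (Zop 5)^[α 5] <| (Zop 6)^[α 6] f

/-- Multi-indices `α` (for the seven fields) with `|α| ≤ s`. -/
def multiIdx (s : ℕ) : Finset (Fin 7 → ℕ) :=
  (Fintype.piFinset fun _ => Finset.range (s + 1)).filter fun α => ∑ i, α i ≤ s

/-- `|v(t,x)|_s = Σ_{|α| ≤ s} |Z^α v(t,x)|`. -/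
def vnorm (s : ℕ) (f : Fn) (t : ℝ) (x : E3) : ℝ :=
  ∑ α ∈ multiIdx s, |Zpow α f t x|

/-- Smoothness of a space-time function. -/
def Smooth (f : Fn) : Prop := ContDiff ℝ (⊤ : ℕ∞) (fun p : ℝ × E3 => f p.1 p.2)

/-- `u` is a smooth solution of `∂_t²u − c²Δu = G` on `(0,∞)×ℝ³`
with zero initial data. -/
def IsWaveSol (c : ℝ) (G u : Fn) : Prop :=
  Smooth u ∧
    (∀ t x, 0 < t → pt (pt u) t x - c ^ 2 * ∑ j, pd j (pd j u) t x = G t x) ∧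
    (∀ x, u 0 x = 0) ∧ (∀ x, pt u 0 x = 0)

/-- `u` is a smooth solution of the free wave equation `∂_t²u − c²Δu = 0`
on `(0,∞)×ℝ³` with initial data `φ, ψ`. -/
def IsFreeWaveSol (c : ℝ) (φ ψ : SFn) (u : Fn) : Prop :=
  Smooth u ∧
    (∀ t x, 0 < t → pt (pt u) t x - c ^ 2 * ∑ j, pd j (pd j u) t x = 0) ∧
    (∀ x, u 0 x = φ x) ∧ (∀ x, pt u 0 x = ψ x)

/-- Extension of the speeds `c_1, …, c_N` by `c_0 = 0`. -/
def cs0 {N : ℕ} (cs : Fin N → ℝ) : Fin (N + 1) → ℝ := Fin.cases 0 cs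

/-- The weight `w(t,r) = min_{0 ≤ j ≤ N} ⟨c_j t − r⟩` (with `c_0 = 0`). -/
def wgt {N : ℕ} (cs : Fin N → ℝ) (t r : ℝ) : ℝ :=
  Finset.univ.inf' Finset.univ_nonempty fun j : Fin (N + 1) => jb (cs0 cs j * t - r)

/-- The weighted sup `A_{ρ,μ,s}[G;c](t,x)` over the backward cone `Λ_c(t,x)`. -/
def Afun (ρ μ : ℝ) (s : ℕ) (G : Fn) (c : ℝ) {N : ℕ} (cs : Fin N → ℝ)
    (t : ℝ) (x : E3) : ℝ :=
  sSup {a : ℝ | ∃ τ : ℝ, ∃ y : E3, 0 ≤ τ ∧ τ ≤ t ∧ ‖y - x‖ ≤ c * (t - τ) ∧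
    a = ‖y‖ * jb (τ + ‖y‖) ^ ρ * wgt cs τ ‖y‖ ^ (1 + μ) * vnorm s G τ y}

/-- Spatial derivative of a function of `x` alone. -/
def sd (j : Fin 3) (φ : SFn) : SFn :=
  fun x => fderiv ℝ φ x (EuclideanSpace.single j 1)

/-- Spatial rotation field for functions of `x` alone. -/
def srot (j k : Fin 3) (φ : SFn) : SFn :=
  fun x => x j * sd k φ x - x k * sd j φ x

/-- The six spatial fields `{∂_1, ∂_2, ∂_3, Ω_{12}, Ω_{13}, Ω_{23}}`. -/
def Sop : Fin 6 → SFn → SFn :=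
  ![sd 0, sd 1, sd 2, srot 0 1, srot 0 2, srot 1 2]

/-- `Z^α` for the spatial fields. -/
def Spow (α : Fin 6 → ℕ) (φ : SFn) : SFn :=
  (Sop 0)^[α 0] <| (Sop 1)^[α 1] <| (Sop 2)^[α 2] <| (Sop 3)^[α 3] <|
    (Sop 4)^[α 4] <| (Sop 5)^[α 5] φ

/-- Spatial multi-indices with `|α| ≤ s`. -/
def smultiIdx (s : ℕ) : Finset (Fin 6 → ℕ) :=
  (Fintype.piFinset fun _ => Finset.range (s + 1)).filter fun α => ∑ i, α i ≤ s

/-- `|φ(x)|_s` for a function of `x` alone. -/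
def snorm (s : ℕ) (φ : SFn) (x : E3) : ℝ :=
  ∑ α ∈ smultiIdx s, |Spow α φ x|

/-- The weighted sup `B_{ρ,s}[φ,ψ;c](t,x)`. -/
def Bfun (ρ : ℝ) (s : ℕ) (φ ψ : SFn) (c t : ℝ) (x : E3) : ℝ :=
  sSup {b : ℝ | ∃ y : E3, ‖y - x‖ ≤ c * t ∧
    b = jb ‖y‖ ^ ρ * (snorm (s + 1) φ y + snorm s ψ y)}

/-- `Φ_ρ(t,r)`. -/
def Phi (ρ t r : ℝ) : ℝ :=
  if ρ = 0 then Real.log (2 + jb (t + r) / jb (t - r)) else jb (t - r) ^ (-ρ)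

/-- `Ψ_ρ(t)`. -/
def Psi (ρ t : ℝ) : ℝ := if ρ = 0 then Real.log (2 + t) else 1

/-- The null form `Q_0(v,w;c) = (∂_t v)(∂_t w) − c²(∇v)·(∇w)`. -/
def Q0f (c : ℝ) (v w : Fn) : Fn :=
  fun t x => pt v t x * pt w t x - c ^ 2 * ∑ j, pd j v t x * pd j w t x

/-- The null form `Q_{ab}(v,w) = (∂_a v)(∂_b w) − (∂_b v)(∂_a w)`. -/
def Qab (a b : Fin 4) (v w : Fn) : Fn :=
  fun t x => pda a v t x * pda b w t x - pda b v t x * pda a w t x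

/-- Lorentz boost `L_{c,j} = (x_j/c)∂_t + c t ∂_j`. -/
def Lb (c : ℝ) (j : Fin 3) (f : Fn) : Fn :=
  fun t x => (x j / c) * pt f t x + c * t * pd j f t x

/-- Scaling field `S = t ∂_t + x·∇_x`. -/
def Sc (f : Fn) : Fn := fun t x => t * pt f t x + ∑ j, x j * pd j f t x

/-- `v(t,r,ω) = r u(t, rω)`. -/
def Vrad (u : Fn) (ω : E3) (t r : ℝ) : ℝ := r * u t (r • ω)

/-- `(∂_t + ∂_r) v` in the variables `(t,r)` for fixed `ω`. -/
def DpV (u : Fn) (ω : E3) (t r : ℝ) : ℝ :=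
  deriv (fun s => Vrad u ω s r) t + deriv (fun ρ' => Vrad u ω t ρ') r

/-- Cross product in ℝ³. -/
def cross3 (a b : Fin 3 → ℝ) : Fin 3 → ℝ :=
  ![a 1 * b 2 - a 2 * b 1, a 2 * b 0 - a 0 * b 2, a 0 * b 1 - a 1 * b 0]

/-- `Ωv = (Ω_{23}v, −Ω_{13}v, Ω_{12}v)`. -/
def OmegaVec (v : Fn) (t : ℝ) (x : E3) : Fin 3 → ℝ :=
  ![rotA 1 2 v t x, -(rotA 0 2 v t x), rotA 0 1 v t x]

/-- `∂^α` for a multi-index with `|α| ≤ 1`: either the identity or a single `∂_a`. -/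
def Dle1 : Option (Fin 4) → Fn → Fn
  | none => id
  | some a => pda a

/-- A linear combination, with constant real coefficients, of the null forms
`Q_0(u_j, ∂^α u_k; c)` and `Q_{ab}(u_j, ∂^α u_k)` with `0 ≤ a < b ≤ 3`, `|α| ≤ 1`. -/
def NullF (c : ℝ) (m : ℕ)
    (a0 : Fin m → Fin m → Fin m → Option (Fin 4) → ℝ)
    (aQ : Fin m → Fin m → Fin m → Fin 4 → Fin 4 → Option (Fin 4) → ℝ)
    (v : Fin m → Fn) (i : Fin m) : Fn := fun t x =>
  (∑ j, ∑ k, ∑ o : Option (Fin 4), a0 i j k o * Q0f c (v j) (Dle1 o (v k)) t x) +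
    ∑ j, ∑ k, ∑ p ∈ Finset.univ.filter (fun p : Fin 4 × Fin 4 => p.1 < p.2),
      ∑ o : Option (Fin 4), aQ i j k p.1 p.2 o * Qab p.1 p.2 (v j) (Dle1 o (v k)) t x

section Proof

open MeasureTheory
open scoped ContDiff

/-- Directional derivative of a space-time function in a space-time direction. -/
def dd (e : ℝ × E3) (f : Fn) : Fn := fun t x => fderiv ℝ (fun p : ℝ × E3 => f p.1 p.2) (t, x) e

lemma Smooth.contDiff {f : Fn} (hf : Smooth f) : ContDiff ℝ ∞ (fun p : ℝ × E3 => f p.1 p.2) := hf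

lemma Smooth.differentiable {f : Fn} (hf : Smooth f) :
    Differentiable ℝ (fun p : ℝ × E3 => f p.1 p.2) :=
  hf.contDiff.differentiable (by simp)

lemma Smooth.contDiff_fderiv {f : Fn} (hf : Smooth f) :
    ContDiff ℝ ∞ (fderiv ℝ (fun p : ℝ × E3 => f p.1 p.2)) :=
  hf.contDiff.fderiv_right (by simp)

lemma Smooth.dd {f : Fn} (hf : Smooth f) (e : ℝ × E3) : Smooth (dd e f) :=
  hf.contDiff_fderiv.clm_apply contDiff_const

lemma Smooth.continuous {f : Fn} (hf : Smooth f) : Continuous (fun p : ℝ × E3 => f p.1 p.2) :=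
  hf.contDiff.continuous

lemma dd_dd {f : Fn} (hf : Smooth f) (e e' : ℝ × E3) (t : ℝ) (x : E3) :
    dd e (dd e' f) t x = fderiv ℝ (fderiv ℝ (fun p : ℝ × E3 => f p.1 p.2)) (t, x) e e' := by
  change fderiv ℝ (fun q : ℝ × E3 => fderiv ℝ (fun p : ℝ × E3 => f p.1 p.2) q e') (t, x) e = _
  rw [fderiv_clm_apply (hf.contDiff_fderiv.differentiable (by simp) _)
    (differentiableAt_const _)]
  simp

lemma Smooth.isSymmSndFDerivAt {f : Fn} (hf : Smooth f) (p : ℝ × E3) :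
    IsSymmSndFDerivAt ℝ (fun p : ℝ × E3 => f p.1 p.2) p :=
  hf.contDiff.contDiffAt.isSymmSndFDerivAt
    (by simp only [minSmoothness_of_isRCLikeNormedField]; exact ENat.LEInfty.out)

lemma dd_comm {f : Fn} (hf : Smooth f) (e e' : ℝ × E3) : dd e (dd e' f) = dd e' (dd e f) := by
  funext t x
  rw [dd_dd hf, dd_dd hf]
  exact hf.isSymmSndFDerivAt _ _ _

lemma pt_eq {f : Fn} (hf : Smooth f) : pt f = dd (1, 0) f := by
  funext t x
  have h1 : HasFDerivAt (fun p : ℝ × E3 => f p.1 p.2) (fderiv ℝ (fun p : ℝ × E3 => f p.1 p.2) (t, x))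
    (t, x) := (hf.differentiable _).hasFDerivAt
  have h2 : HasDerivAt (fun s : ℝ => (s, x)) ((1 : ℝ), (0 : E3)) t :=
    (hasDerivAt_id t).prodMk (hasDerivAt_const t x)
  exact (h1.comp_hasDerivAt t h2).deriv

lemma pd_eq {f : Fn} (hf : Smooth f) (j : Fin 3) :
    pd j f = dd (0, EuclideanSpace.single j 1) f := by
  funext t x
  have h1 : HasFDerivAt (fun p : ℝ × E3 => f p.1 p.2) (fderiv ℝ (fun p : ℝ × E3 => f p.1 p.2) (t, x))
    (t, x) := (hf.differentiable _).hasFDerivAt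
  have h2 : HasFDerivAt (fun y : E3 => (t, y)) (ContinuousLinearMap.inr ℝ ℝ E3) x :=
    hasFDerivAt_prodMk_right t x
  have h3 := (h1.comp x h2).fderiv
  change fderiv ℝ ((fun p : ℝ × E3 => f p.1 p.2) ∘ fun y : E3 => (t, y)) x _ = _
  rw [h3]
  simp [PaperKatayama.dd]

lemma Smooth.pt {f : Fn} (hf : Smooth f) : Smooth (pt f) := by
  rw [pt_eq hf]; exact hf.dd _

lemma Smooth.pd {f : Fn} (hf : Smooth f) (j : Fin 3) : Smooth (pd j f) := by
  rw [pd_eq hf]; exact hf.dd _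

lemma pd_comm {f : Fn} (hf : Smooth f) (i j : Fin 3) : pd i (pd j f) = pd j (pd i f) := by
  rw [pd_eq (hf.pd j), pd_eq (hf.pd i), pd_eq hf, pd_eq hf, dd_comm hf]

lemma pt_pd_comm {f : Fn} (hf : Smooth f) (j : Fin 3) : pt (pd j f) = pd j (pt f) := by
  rw [pt_eq (hf.pd j), pd_eq hf.pt, pt_eq hf, pd_eq hf, dd_comm hf]

lemma contDiff_coord (j : Fin 3) : ContDiff ℝ ∞ (fun p : ℝ × E3 => p.2 j) := by
  have : ContDiff ℝ ∞ (fun y : E3 => y j) := (EuclideanSpace.proj j : E3 →L[ℝ] ℝ).contDiff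
  exact this.comp contDiff_snd

lemma Smooth.rotA {f : Fn} (hf : Smooth f) (j k : Fin 3) : Smooth (rotA j k f) :=
  ((contDiff_coord j).mul (hf.pd k).contDiff).sub ((contDiff_coord k).mul (hf.pd j).contDiff)

lemma Smooth.differentiable_slice {f : Fn} (hf : Smooth f) (t : ℝ) : Differentiable ℝ (f t) :=
  fun x => (hf.differentiable (t, x)).comp x
    (hasFDerivAt_prodMk_right (𝕜 := ℝ) t x).differentiableAt

lemma Smooth.differentiable_time {f : Fn} (hf : Smooth f) (x : E3) :
    Differentiable ℝ (fun s => f s x) :=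
  fun t => DifferentiableAt.comp (f := fun s : ℝ => (s, x)) t (hf.differentiable (t, x))
    (hasFDerivAt_prodMk_left (𝕜 := ℝ) t x).differentiableAt

lemma hasFDerivAt_coord (k : Fin 3) (x : E3) :
    HasFDerivAt (fun y : E3 => y k) (EuclideanSpace.proj k : E3 →L[ℝ] ℝ) x :=
  (EuclideanSpace.proj k : E3 →L[ℝ] ℝ).hasFDerivAt

lemma pd_coord_mul {f : Fn} (hf : Smooth f) (i k : Fin 3) (t : ℝ) (x : E3) :
    pd i (fun t x => x k * f t x) t x = (if k = i then 1 else 0) * f t x + x k * pd i f t x := by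
  have h := ((hasFDerivAt_coord k x).mul (hf.differentiable_slice t x).hasFDerivAt).fderiv
  change fderiv ℝ ((fun y : E3 => y k) * f t) x _ = _
  rw [h]
  simp [PaperKatayama.pd, PiLp.single_apply]
  ring

lemma pd_add {f g : Fn} (hf : Smooth f) (hg : Smooth g) (i : Fin 3) :
    pd i (fun t x => f t x + g t x) = fun t x => pd i f t x + pd i g t x := by
  funext t x
  simp only [PaperKatayama.pd]
  rw [fderiv_fun_add (hf.differentiable_slice t x) (hg.differentiable_slice t x)]; rfl

lemma pd_sub {f g : Fn} (hf : Smooth f) (hg : Smooth g) (i : Fin 3) :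
    pd i (fun t x => f t x - g t x) = fun t x => pd i f t x - pd i g t x := by
  funext t x
  simp only [PaperKatayama.pd]
  rw [fderiv_fun_sub (hf.differentiable_slice t x) (hg.differentiable_slice t x)]; rfl

lemma pd_const_mul {f : Fn} (hf : Smooth f) (i : Fin 3) (a : ℝ) :
    pd i (fun t x => a * f t x) = fun t x => a * pd i f t x := by
  funext t x
  simp only [PaperKatayama.pd]
  rw [fderiv_const_mul (hf.differentiable_slice t x)]; rfl

lemma pt_sub {f g : Fn} (hf : Smooth f) (hg : Smooth g) :
    pt (fun t x => f t x - g t x) = fun t x => pt f t x - pt g t x := by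
  funext t x
  exact deriv_fun_sub (hf.differentiable_time x t) (hg.differentiable_time x t)

lemma Smooth.coord_mul {f : Fn} (hf : Smooth f) (j : Fin 3) : Smooth (fun t x => x j * f t x) :=
  (contDiff_coord j).mul hf.contDiff

lemma Smooth.add {f g : Fn} (hf : Smooth f) (hg : Smooth g) : Smooth (fun t x => f t x + g t x) :=
  hf.contDiff.add hg.contDiff

lemma Smooth.sub {f g : Fn} (hf : Smooth f) (hg : Smooth g) : Smooth (fun t x => f t x - g t x) :=
  hf.contDiff.sub hg.contDiff

lemma Smooth.const_mul {f : Fn} (hf : Smooth f) (a : ℝ) : Smooth (fun t x => a * f t x) :=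
  contDiff_const.mul hf.contDiff

lemma pt_rotA {f : Fn} (hf : Smooth f) (j k : Fin 3) : pt (rotA j k f) = rotA j k (pt f) := by
  funext t x
  change deriv (fun s => x j * pd k f s x - x k * pd j f s x) t = _
  rw [deriv_fun_sub (((hf.pd k).differentiable_time x t).const_mul _)
    (((hf.pd j).differentiable_time x t).const_mul _),
    deriv_const_mul _ ((hf.pd k).differentiable_time x t),
    deriv_const_mul _ ((hf.pd j).differentiable_time x t)]
  change x j * pt (pd k f) t x - x k * pt (pd j f) t x = _
  rw [pt_pd_comm hf, pt_pd_comm hf]; rfl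

lemma pd_rotA {f : Fn} (hf : Smooth f) (i j k : Fin 3) :
    pd i (rotA j k f) = fun t x => (if j = i then 1 else 0) * pd k f t x
      - (if k = i then 1 else 0) * pd j f t x + rotA j k (pd i f) t x := by
  funext t x
  have h1 : rotA j k f = fun t x => (x j * pd k f t x) - (x k * pd j f t x) := rfl
  rw [h1, pd_sub ((hf.pd k).coord_mul j) ((hf.pd j).coord_mul k)]
  simp only [pd_coord_mul (hf.pd k), pd_coord_mul (hf.pd j), PaperKatayama.rotA]
  rw [pd_comm hf i j, pd_comm hf i k]
  ring

lemma pd_pd_rotA {f : Fn} (hf : Smooth f) (i j k : Fin 3) (t : ℝ) (x : E3) :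
    pd i (pd i (rotA j k f)) t x = 2 * ((if j = i then 1 else 0) * pd k (pd i f) t x
      - (if k = i then 1 else 0) * pd j (pd i f) t x) + rotA j k (pd i (pd i f)) t x := by
  rw [pd_rotA hf, pd_add (((hf.pd k).const_mul _).sub ((hf.pd j).const_mul _)) ((hf.pd i).rotA j k),
    pd_sub ((hf.pd k).const_mul _) ((hf.pd j).const_mul _), pd_const_mul (hf.pd k),
    pd_const_mul (hf.pd j), pd_rotA (hf.pd i), pd_comm hf i k, pd_comm hf i j]
  ring

/-- The wave operator `∂_t² − c²Δ`. -/
def box (c : ℝ) (f : Fn) : Fn := fun t x => pt (pt f) t x - c ^ 2 * ∑ j, pd j (pd j f) t x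

lemma Smooth.lap {f : Fn} (hf : Smooth f) :
    Smooth (fun t x => ∑ j, PaperKatayama.pd j (PaperKatayama.pd j f) t x) := by
  have : ContDiff ℝ ∞ (fun p : ℝ × E3 =>
      ∑ j : Fin 3, PaperKatayama.pd j (PaperKatayama.pd j f) p.1 p.2) :=
    ContDiff.sum fun j _ => ((hf.pd j).pd j).contDiff
  exact this

lemma Smooth.box {f : Fn} (hf : Smooth f) (c : ℝ) : Smooth (box c f) :=
  hf.pt.pt.sub (hf.lap.const_mul _)

lemma pd_lap {f : Fn} (hf : Smooth f) (i : Fin 3) :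
    pd i (fun t x => ∑ j, pd j (pd j f) t x) = fun t x => ∑ j, pd j (pd j (pd i f)) t x := by
  funext t x
  have : pd i (fun t x => ∑ j, pd j (pd j f) t x) t x = ∑ j, pd i (pd j (pd j f)) t x := by
    change fderiv ℝ (fun x => ∑ j, pd j (pd j f) t x) x _ = _
    rw [fderiv_fun_sum fun j _ => ((hf.pd j).pd j).differentiable_slice t x]
    rw [_root_.sum_apply]; rfl
  rw [this]
  refine Finset.sum_congr rfl fun j _ => ?_
  rw [pd_comm (hf.pd j), pd_comm hf i j]

lemma pt_lap {f : Fn} (hf : Smooth f) :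
    pt (fun t x => ∑ j, pd j (pd j f) t x) = fun t x => ∑ j, pd j (pd j (pt f)) t x := by
  funext t x
  have : pt (fun t x => ∑ j, pd j (pd j f) t x) t x = ∑ j, pt (pd j (pd j f)) t x := by
    change deriv (fun s => ∑ j, pd j (pd j f) s x) t = _
    rw [deriv_fun_sum fun j _ => ((hf.pd j).pd j).differentiable_time x t]
    rfl
  rw [this]
  refine Finset.sum_congr rfl fun j _ => ?_
  rw [pt_pd_comm (hf.pd j), pt_pd_comm hf j]

lemma box_pd {f : Fn} (hf : Smooth f) (c : ℝ) (i : Fin 3) : box c (pd i f) = pd i (box c f) := by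
  have h : box c f = fun t x => pt (pt f) t x - c ^ 2 * ∑ j, pd j (pd j f) t x := rfl
  rw [h, pd_sub hf.pt.pt (hf.lap.const_mul _), pd_const_mul hf.lap, pd_lap hf]
  unfold PaperKatayama.box
  rw [pt_pd_comm hf, pt_pd_comm hf.pt]

lemma box_pt {f : Fn} (hf : Smooth f) (c : ℝ) : box c (pt f) = pt (box c f) := by
  have h : box c f = fun t x => pt (pt f) t x - c ^ 2 * ∑ j, pd j (pd j f) t x := rfl
  rw [h, pt_sub hf.pt.pt (hf.lap.const_mul _)]
  have h2 : pt (fun t x => c ^ 2 * ∑ j, pd j (pd j f) t x) =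
      fun t x => c ^ 2 * pt (fun t x => ∑ j, pd j (pd j f) t x) t x := by
    funext t x
    exact deriv_const_mul _ (hf.lap.differentiable_time x t)
  rw [h2, pt_lap hf]
  rfl

lemma box_rotA {f : Fn} (hf : Smooth f) (c : ℝ) (j k : Fin 3) :
    box c (rotA j k f) = rotA j k (box c f) := by
  funext t x
  have h : box c f = fun t x => pt (pt f) t x - c ^ 2 * ∑ j, pd j (pd j f) t x := rfl
  have e : ∀ i, pd i (box c f) t x = pt (pt (pd i f)) t x - c ^ 2 * ∑ j, pd j (pd j (pd i f)) t x := by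
    intro i
    rw [← box_pd hf]; rfl
  unfold PaperKatayama.rotA
  rw [e, e]
  change pt (pt (rotA j k f)) t x - c ^ 2 * ∑ i, pd i (pd i (rotA j k f)) t x = _
  rw [pt_rotA hf, pt_rotA hf.pt]
  simp only [pd_pd_rotA hf]
  have s1 : ∀ i, pd k (pd i (pd i f)) = pd i (pd i (pd k f)) := fun i => by
    rw [pd_comm (hf.pd i), pd_comm hf k i]
  have s2 : ∀ i, pd j (pd i (pd i f)) = pd i (pd i (pd j f)) := fun i => by
    rw [pd_comm (hf.pd i), pd_comm hf j i]
  simp only [PaperKatayama.rotA, s1, s2, pt_pd_comm hf, pt_pd_comm hf.pt]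
  simp only [Finset.sum_add_distrib, Finset.sum_sub_distrib, ← Finset.mul_sum, ite_mul, one_mul,
    zero_mul, Finset.sum_ite_eq, Finset.mem_univ, if_true]
  rw [pd_comm hf k j]
  ring

lemma intervalIntegral_swap_of_continuous {F : ℝ → ℝ → ℝ}
    (hF : Continuous fun p : ℝ × ℝ => F p.1 p.2) (a b c d : ℝ) :
    ∫ x in a..b, ∫ y in c..d, F x y = ∫ y in c..d, ∫ x in a..b, F x y := by
  refine intervalIntegral_intervalIntegral_swap ?_
  have h : IntegrableOn F.uncurry (Set.uIcc a b ×ˢ Set.uIcc c d) :=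
    hF.continuousOn.integrableOn_compact (isCompact_uIcc.prod isCompact_uIcc)
  exact h.mono_set (Set.prod_mono Set.uIoc_subset_uIcc Set.uIoc_subset_uIcc)

lemma continuous_integral {X : Type*} [TopologicalSpace X] {F : X → ℝ → ℝ}
    (hF : Continuous fun p : X × ℝ => F p.1 p.2) (a b : ℝ) :
    Continuous fun x => ∫ y in a..b, F x y :=
  intervalIntegral.continuous_parametric_intervalIntegral_of_continuous' hF a b

/-- The divergence theorem on a box, for a field whose fluxes through four of the faces cancel. -/
lemma integral_box_divergence {P Q R P' Q' R' : ℝ → ℝ → ℝ → ℝ} {a b c : ℝ}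
    (cP : Continuous fun p : (ℝ × ℝ) × ℝ => P' p.1.1 p.1.2 p.2)
    (cQ : Continuous fun p : (ℝ × ℝ) × ℝ => Q' p.1.1 p.1.2 p.2)
    (cR : Continuous fun p : (ℝ × ℝ) × ℝ => R' p.1.1 p.1.2 p.2)
    (hP : ∀ x y z, HasDerivAt (fun x => P x y z) (P' x y z) x)
    (hQ : ∀ x y z, HasDerivAt (fun y => Q x y z) (Q' x y z) y)
    (hR : ∀ x y z, HasDerivAt (fun z => R x y z) (R' x y z) z)
    (bQ : ∀ x z, Q x 0 z = Q x b z) (bR : ∀ x y, R x y 0 = R x y c) :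
    ∫ x in 0..a, ∫ y in 0..b, ∫ z in 0..c, (P' x y z + Q' x y z + R' x y z) =
      ∫ y in 0..b, ∫ z in 0..c, (P a y z - P 0 y z) := by
  have e1 : ∀ x y, ∫ z in 0..c, (P' x y z + Q' x y z + R' x y z) =
      (∫ z in 0..c, P' x y z) + ∫ z in 0..c, Q' x y z := by
    intro x y
    have i1 : Continuous fun z => P' x y z := cP.comp (by fun_prop : Continuous fun z : ℝ => ((x, y), z))
    have i2 : Continuous fun z => Q' x y z := cQ.comp (by fun_prop : Continuous fun z : ℝ => ((x, y), z))
    have i3 : Continuous fun z => R' x y z := cR.comp (by fun_prop : Continuous fun z : ℝ => ((x, y), z))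
    rw [intervalIntegral.integral_add ((by fun_prop :
        Continuous fun z => P' x y z + Q' x y z).intervalIntegrable _ _)
      (i3.intervalIntegrable _ _), intervalIntegral.integral_add (i1.intervalIntegrable _ _)
      (i2.intervalIntegrable _ _),
      intervalIntegral.integral_eq_sub_of_hasDerivAt (fun z _ => hR x y z)
        (i3.intervalIntegrable _ _), bR x y]
    ring
  have e2 : ∀ x, ∫ y in 0..b, ∫ z in 0..c, (P' x y z + Q' x y z + R' x y z) =
      ∫ y in 0..b, ∫ z in 0..c, P' x y z := by
    intro x
    simp only [e1]
    have i1 : Continuous fun p : ℝ × ℝ => P' x p.1 p.2 :=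
      cP.comp (by fun_prop : Continuous fun p : ℝ × ℝ => ((x, p.1), p.2))
    have i2 : Continuous fun p : ℝ × ℝ => Q' x p.1 p.2 :=
      cQ.comp (by fun_prop : Continuous fun p : ℝ × ℝ => ((x, p.1), p.2))
    rw [intervalIntegral.integral_add ((continuous_integral i1 0 c).intervalIntegrable _ _)
      ((continuous_integral i2 0 c).intervalIntegrable _ _),
      intervalIntegral_swap_of_continuous (F := fun y z => Q' x y z) i2]
    have : ∀ z, ∫ y in 0..b, Q' x y z = 0 := by
      intro z
      have i4 : Continuous fun y => Q' x y z := i2.comp (by fun_prop : Continuous fun y : ℝ => (y, z))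
      rw [intervalIntegral.integral_eq_sub_of_hasDerivAt (fun y _ => hQ x y z)
        (i4.intervalIntegrable _ _), bQ x z, sub_self]
    simp [this]
  simp only [e2]
  rw [intervalIntegral_swap_of_continuous (F := fun x y => ∫ z in 0..c, P' x y z)
    (continuous_integral (X := ℝ × ℝ) (F := fun p z => P' p.1 p.2 z) cP 0 c)]
  refine intervalIntegral.integral_congr fun y _ => ?_
  have i1 : Continuous fun p : ℝ × ℝ => P' p.1 y p.2 :=
    cP.comp (by fun_prop : Continuous fun p : ℝ × ℝ => ((p.1, y), p.2))
  rw [intervalIntegral_swap_of_continuous (F := fun x z => P' x y z) i1]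
  refine intervalIntegral.integral_congr fun z _ => ?_
  have i4 : Continuous fun x => P' x y z := i1.comp (by fun_prop : Continuous fun x : ℝ => (x, z))
  exact intervalIntegral.integral_eq_sub_of_hasDerivAt (fun x _ => hP x y z)
        (i4.intervalIntegrable _ _)

lemma sum_bilin_orthonormalBasis (B : E3 →L[ℝ] E3 →L[ℝ] ℝ) (b : OrthonormalBasis (Fin 3) ℝ E3) :
    ∑ i, B (b i) (b i) = ∑ j, B (EuclideanSpace.single j 1) (EuclideanSpace.single j 1) := by
  have h := InnerProductSpace.canonicalCovariantTensor_eq_sum E3 b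
  have h' := InnerProductSpace.canonicalCovariantTensor_eq_sum E3 (EuclideanSpace.basisFun (Fin 3) ℝ)
  have := congrArg (TensorProduct.lift ((ContinuousLinearMap.coeLM ℝ).comp B.toLinearMap)) (h.symm.trans h')
  simpa using this

lemma exists_orthonormalBasis_third {w : E3} (hw : ‖w‖ = 1) :
    ∃ b : OrthonormalBasis (Fin 3) ℝ E3, b 2 = w := by
  have hv : Orthonormal ℝ (({2} : Set (Fin 3)).domRestrict fun _ => w) := by
    constructor
    · intro i; simpa using hw
    · intro i j hij; exact absurd (Subsingleton.elim i j) hij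
  obtain ⟨b, hb⟩ := hv.exists_orthonormalBasis_extension_of_card_eq (by simp)
  exact ⟨b, hb 2 rfl⟩

/-- The unit vector with polar angle `θ` and azimuth `φ` in the frame `b`. -/
def sph (b : OrthonormalBasis (Fin 3) ℝ E3) (θ φ : ℝ) : E3 :=
  Real.sin θ • (Real.cos φ • b 0 + Real.sin φ • b 1) + Real.cos θ • b 2

/-- The polar derivative of `sph`. -/
def sphPolar (b : OrthonormalBasis (Fin 3) ℝ E3) (θ φ : ℝ) : E3 :=
  Real.cos θ • (Real.cos φ • b 0 + Real.sin φ • b 1) - Real.sin θ • b 2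

/-- The normalized azimuthal derivative of `sph`. -/
def sphAzim (b : OrthonormalBasis (Fin 3) ℝ E3) (φ : ℝ) : E3 :=
  -Real.sin φ • b 0 + Real.cos φ • b 1

lemma box_eq {v : Fn} (hv : Smooth v) (c : ℝ) (b : OrthonormalBasis (Fin 3) ℝ E3) (t : ℝ) (x : E3) :
    box c v t x = fderiv ℝ (fderiv ℝ (fun p : ℝ × E3 => v p.1 p.2)) (t, x) (1, 0) (1, 0) -
      c ^ 2 * ∑ i, fderiv ℝ (fderiv ℝ (fun p : ℝ × E3 => v p.1 p.2)) (t, x) (0, b i) (0, b i) := by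
  unfold box
  rw [pt_eq hv.pt, pt_eq hv, dd_dd hv]
  have h : ∀ j, pd j (pd j v) t x = fderiv ℝ (fderiv ℝ (fun p : ℝ × E3 => v p.1 p.2)) (t, x)
      (0, EuclideanSpace.single j 1) (0, EuclideanSpace.single j 1) := by
    intro j
    rw [pd_eq (hv.pd j), pd_eq hv, dd_dd hv]
  simp only [h]
  have := sum_bilin_orthonormalBasis ((fderiv ℝ (fderiv ℝ (fun p : ℝ × E3 => v p.1 p.2))
    (t, x)).bilinearComp (ContinuousLinearMap.inr ℝ ℝ E3) (ContinuousLinearMap.inr ℝ ℝ E3)) b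
  simp only [ContinuousLinearMap.bilinearComp_apply, ContinuousLinearMap.inr_apply] at this
  rw [this]

lemma cone_divergence_identity (D : ℝ × E3 →L[ℝ] ℝ) (H : ℝ × E3 →L[ℝ] ℝ × E3 →L[ℝ] ℝ)
    (hH : ∀ v w, H v w = H w v) (b : OrthonormalBasis (Fin 3) ℝ E3) {c : ℝ} (ρ θ φ : ℝ) :
    Real.sin θ * (D (-c⁻¹, sph b θ φ) + (D (c⁻¹, sph b θ φ) +
        ρ * H (-c⁻¹, sph b θ φ) (c⁻¹, sph b θ φ))) +
      (Real.cos θ * D (0, sphPolar b θ φ) + Real.sin θ *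
        (H (0, ρ • sphPolar b θ φ) (0, sphPolar b θ φ) + D (0, -sph b θ φ))) +
      (H (0, (ρ * Real.sin θ) • sphAzim b φ) (0, sphAzim b φ) +
        D (0, -(Real.cos φ • b 0 + Real.sin φ • b 1))) =
    ρ * Real.sin θ * (∑ i, H (0, b i) (0, b i) - (c⁻¹) ^ 2 * H (1, 0) (1, 0)) := by
  have e1 : ∀ a : ℝ, ((a, sph b θ φ) : ℝ × E3) = a • ((1 : ℝ), (0 : E3)) +
      (Real.sin θ * Real.cos φ) • (0, b 0) + (Real.sin θ * Real.sin φ) • (0, b 1) +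
      Real.cos θ • (0, b 2) := fun a => by
    ext1 <;> simp [sph, smul_smul]
  have e2 : ((0, sphPolar b θ φ) : ℝ × E3) = (Real.cos θ * Real.cos φ) • (0, b 0) +
      (Real.cos θ * Real.sin φ) • (0, b 1) - Real.sin θ • (0, b 2) := by
    ext1 <;> simp [sphPolar, smul_smul]
  have e3 : ((0, sphAzim b φ) : ℝ × E3) = -Real.sin φ • (0, b 0) + Real.cos φ • (0, b 1) := by
    ext1 <;> simp [sphAzim]
  have e4 : ((0, -sph b θ φ) : ℝ × E3) = -(0, sph b θ φ) := by simp
  have e5 : ∀ (a : ℝ) (w : E3), ((0, a • w) : ℝ × E3) = a • (0, w) := fun a w => by simp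
  have e6 : ((0, -(Real.cos φ • b 0 + Real.sin φ • b 1)) : ℝ × E3) =
      -(Real.cos φ • (0, b 0) + Real.sin φ • (0, b 1)) := by simp
  rw [e6, e5, e5, e4, e3, e2, e1, e1, e1]
  simp only [map_add, map_sub, map_neg, map_smul, add_apply,
    sub_apply, smul_apply,
    smul_eq_mul, Fin.sum_univ_three]
  generalize ((1 : ℝ), (0 : E3)) = T
  generalize ((0 : ℝ), b 0) = X
  generalize ((0 : ℝ), b 1) = Y
  generalize ((0 : ℝ), b 2) = Z
  rw [hH X T, hH Y T, hH Z T, hH Y X, hH Z X, hH Z Y]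
  have s1 := Real.sin_sq_add_cos_sq θ
  have s2 := Real.sin_sq_add_cos_sq φ
  linear_combination (Real.cos φ * D X + Real.sin φ * D Y + ρ * Real.sin θ * (Real.cos φ ^ 2 * H X X
    + 2 * Real.cos φ * Real.sin φ * H X Y + Real.sin φ ^ 2 * H Y Y + H Z Z)) * s1 +
    ρ * Real.sin θ * (H X X + H Y Y) * s2

lemma hasDerivAt_sph_polar (b : OrthonormalBasis (Fin 3) ℝ E3) (θ φ : ℝ) :
    HasDerivAt (fun θ => sph b θ φ) (sphPolar b θ φ) θ := by
  have := ((Real.hasDerivAt_sin θ).smul_const (Real.cos φ • b 0 + Real.sin φ • b 1)).add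
    ((Real.hasDerivAt_cos θ).smul_const (b 2))
  refine this.congr_deriv ?_
  simp [sphPolar, sub_eq_add_neg]

lemma hasDerivAt_sphPolar_polar (b : OrthonormalBasis (Fin 3) ℝ E3) (θ φ : ℝ) :
    HasDerivAt (fun θ => sphPolar b θ φ) (-sph b θ φ) θ := by
  have := ((Real.hasDerivAt_cos θ).smul_const (Real.cos φ • b 0 + Real.sin φ • b 1)).sub
    ((Real.hasDerivAt_sin θ).smul_const (b 2))
  refine this.congr_deriv ?_
  simp only [sph, neg_smul]; abel

lemma hasDerivAt_sph_azim (b : OrthonormalBasis (Fin 3) ℝ E3) (θ φ : ℝ) :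
    HasDerivAt (fun φ => sph b θ φ) (Real.sin θ • sphAzim b φ) φ :=
  ((((Real.hasDerivAt_cos φ).smul_const (b 0)).add
    ((Real.hasDerivAt_sin φ).smul_const (b 1))).const_smul (Real.sin θ)).add_const _

lemma hasDerivAt_sphAzim (b : OrthonormalBasis (Fin 3) ℝ E3) (φ : ℝ) :
    HasDerivAt (fun φ => sphAzim b φ) (-(Real.cos φ • b 0 + Real.sin φ • b 1)) φ := by
  have := ((Real.hasDerivAt_sin φ).fun_neg.smul_const (b 0)).add
    ((Real.hasDerivAt_cos φ).smul_const (b 1))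
  refine this.congr_deriv ?_
  simp only [neg_smul]; abel

@[fun_prop]
lemma Continuous.sph {X : Type*} [TopologicalSpace X] (b : OrthonormalBasis (Fin 3) ℝ E3)
    {f g : X → ℝ} (hf : Continuous f) (hg : Continuous g) :
    Continuous fun p => sph b (f p) (g p) := by
  unfold PaperKatayama.sph; fun_prop

@[fun_prop]
lemma Continuous.sphPolar {X : Type*} [TopologicalSpace X] (b : OrthonormalBasis (Fin 3) ℝ E3)
    {f g : X → ℝ} (hf : Continuous f) (hg : Continuous g) :
    Continuous fun p => sphPolar b (f p) (g p) := by
  unfold PaperKatayama.sphPolar; fun_prop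

@[fun_prop]
lemma Continuous.sphAzim {X : Type*} [TopologicalSpace X] (b : OrthonormalBasis (Fin 3) ℝ E3)
    {f : X → ℝ} (hf : Continuous f) : Continuous fun p => sphAzim b (f p) := by
  unfold PaperKatayama.sphAzim; fun_prop

/-- The point at distance `ρ` from the vertex on the backward cone. -/
def conePt (c t : ℝ) (x : E3) (b : OrthonormalBasis (Fin 3) ℝ E3) (ρ θ φ : ℝ) : ℝ × E3 :=
  (t - c⁻¹ * ρ, x + ρ • sph b θ φ)

lemma continuous_conePt (c t : ℝ) (x : E3) (b : OrthonormalBasis (Fin 3) ℝ E3) :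
    Continuous fun p : (ℝ × ℝ) × ℝ => conePt c t x b p.1.1 p.1.2 p.2 := by
  unfold conePt
  fun_prop

lemma hasDerivAt_conePt_radial (c t : ℝ) (x : E3) (b : OrthonormalBasis (Fin 3) ℝ E3) (ρ θ φ : ℝ) :
    HasDerivAt (fun ρ => conePt c t x b ρ θ φ) (-c⁻¹, sph b θ φ) ρ := by
  refine HasDerivAt.prodMk ?_ ?_
  · simpa using ((hasDerivAt_id ρ).const_mul c⁻¹).const_sub t
  · simpa using ((hasDerivAt_id ρ).smul_const (sph b θ φ)).const_add x

lemma hasDerivAt_conePt_polar (c t : ℝ) (x : E3) (b : OrthonormalBasis (Fin 3) ℝ E3) (ρ θ φ : ℝ) :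
    HasDerivAt (fun θ => conePt c t x b ρ θ φ) (0, ρ • sphPolar b θ φ) θ :=
  (hasDerivAt_const _ _).prodMk (((hasDerivAt_sph_polar b θ φ).const_smul ρ).const_add x)

lemma hasDerivAt_conePt_azim (c t : ℝ) (x : E3) (b : OrthonormalBasis (Fin 3) ℝ E3) (ρ θ φ : ℝ) :
    HasDerivAt (fun φ => conePt c t x b ρ θ φ) (0, (ρ * Real.sin θ) • sphAzim b φ) φ := by
  rw [mul_smul]
  exact (hasDerivAt_const _ _).prodMk (((hasDerivAt_sph_azim b θ φ).const_smul ρ).const_add x)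

set_option maxHeartbeats 1000000 in
/-- The divergence theorem on a backward cone in spherical coordinates. -/
lemma cone_divergence {F : ℝ × E3 → ℝ} {D : ℝ × E3 → ℝ × E3 →L[ℝ] ℝ}
    {H : ℝ × E3 → ℝ × E3 →L[ℝ] ℝ × E3 →L[ℝ] ℝ} (hF : ∀ p, HasFDerivAt F (D p) p)
    (hD : ∀ p, HasFDerivAt D (H p) p) (hH : Continuous H) (hs : ∀ p v w, H p v w = H p w v)
    (c t a : ℝ) (x : E3) (b : OrthonormalBasis (Fin 3) ℝ E3) :
    ∫ ρ in 0..a, ∫ θ in 0..Real.pi, ∫ φ in 0..2 * Real.pi, ρ * Real.sin θ *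
        (∑ i, H (conePt c t x b ρ θ φ) (0, b i) (0, b i) -
          (c⁻¹) ^ 2 * H (conePt c t x b ρ θ φ) (1, 0) (1, 0)) =
      ∫ θ in 0..Real.pi, ∫ φ in 0..2 * Real.pi,
        (Real.sin θ * (F (conePt c t x b a θ φ) +
            a * D (conePt c t x b a θ φ) (c⁻¹, sph b θ φ)) -
          Real.sin θ * (F (conePt c t x b 0 θ φ) +
            0 * D (conePt c t x b 0 θ φ) (c⁻¹, sph b θ φ))) := by
  have cD : Continuous D := continuous_iff_continuousAt.2 fun p => (hD p).continuousAt
  have zρ := hasDerivAt_conePt_radial c t x b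
  have zθ := hasDerivAt_conePt_polar c t x b
  have zφ := hasDerivAt_conePt_azim c t x b
  have cz := continuous_conePt c t x b
  have c1z : Continuous fun p : (ℝ × ℝ) × ℝ => D (conePt c t x b p.1.1 p.1.2 p.2) := cD.comp cz
  have c2z : Continuous fun p : (ℝ × ℝ) × ℝ => H (conePt c t x b p.1.1 p.1.2 p.2) := hH.comp cz
  have cs1 : Continuous fun p : (ℝ × ℝ) × ℝ => Real.sin p.1.2 := by fun_prop
  have cr : Continuous fun p : (ℝ × ℝ) × ℝ => p.1.1 := by fun_prop
  have z2 : ∀ ρ θ, conePt c t x b ρ θ 0 = conePt c t x b ρ θ (2 * Real.pi) := by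
    intro ρ θ; simp [conePt, sph]
  have n2 : sphAzim b 0 = sphAzim b (2 * Real.pi) := by simp [sphAzim]
  generalize conePt c t x b = z at *
  rw [← integral_box_divergence (a := a) (b := Real.pi) (c := 2 * Real.pi)
    (P := fun ρ θ φ => Real.sin θ * (F (z ρ θ φ) + ρ * D (z ρ θ φ) (c⁻¹, sph b θ φ)))
    (P' := fun ρ θ φ => Real.sin θ * (D (z ρ θ φ) (-c⁻¹, sph b θ φ) +
      (D (z ρ θ φ) (c⁻¹, sph b θ φ) + ρ * H (z ρ θ φ) (-c⁻¹, sph b θ φ) (c⁻¹, sph b θ φ))))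
    (Q := fun ρ θ φ => Real.sin θ * D (z ρ θ φ) (0, sphPolar b θ φ))
    (Q' := fun ρ θ φ => Real.cos θ * D (z ρ θ φ) (0, sphPolar b θ φ) + Real.sin θ *
        (H (z ρ θ φ) (0, ρ • sphPolar b θ φ) (0, sphPolar b θ φ) +
          D (z ρ θ φ) (0, -sph b θ φ)))
    (R := fun ρ θ φ => D (z ρ θ φ) (0, sphAzim b φ))
    (R' := fun ρ θ φ => H (z ρ θ φ) (0, (ρ * Real.sin θ) • sphAzim b φ) (0, sphAzim b φ) +
        D (z ρ θ φ) (0, -(Real.cos φ • b 0 + Real.sin φ • b 1)))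
    (cs1.mul ((c1z.clm_apply (by fun_prop)).add ((c1z.clm_apply (by fun_prop)).add
      (cr.mul ((c2z.clm_apply (by fun_prop)).clm_apply (by fun_prop))))))
    (((Real.continuous_cos.comp (continuous_snd.comp continuous_fst)).mul
      (c1z.clm_apply (by fun_prop))).add (cs1.mul
      (((c2z.clm_apply (by fun_prop)).clm_apply (by fun_prop)).add (c1z.clm_apply (by fun_prop)))))
    (((c2z.clm_apply (by fun_prop)).clm_apply (by fun_prop)).add (c1z.clm_apply (by fun_prop)))
    (by
      intro ρ θ φ
      have h1 := (hF (z ρ θ φ)).comp_hasDerivAt ρ (zρ ρ θ φ)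
      have h2 := ((hD (z ρ θ φ)).comp_hasDerivAt ρ (zρ ρ θ φ)).clm_apply
        (hasDerivAt_const ρ (c⁻¹, sph b θ φ))
      have h3 := (h1.add ((hasDerivAt_id ρ).mul h2)).const_mul (Real.sin θ)
      refine h3.congr_deriv ?_
      simp)
    (by
      intro ρ θ φ
      have h2 := ((hD (z ρ θ φ)).comp_hasDerivAt θ (zθ ρ θ φ)).clm_apply
        ((hasDerivAt_const θ (0 : ℝ)).prodMk (hasDerivAt_sphPolar_polar b θ φ))
      exact (Real.hasDerivAt_sin θ).mul h2)
    (by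
      intro ρ θ φ
      exact ((hD (z ρ θ φ)).comp_hasDerivAt φ (zφ ρ θ φ)).clm_apply
        ((hasDerivAt_const φ (0 : ℝ)).prodMk (hasDerivAt_sphAzim b φ)))
    (by intro ρ φ; simp)
    (by intro ρ θ; rw [z2, n2])]
  simp only [cone_divergence_identity _ _ (hs _) b (c := c)]

/-- Kirchhoff's formula for a function vanishing at the initial time, in spherical coordinates
with respect to an arbitrary orthonormal frame. -/
lemma kirchhoff {v : Fn} (hv : Smooth v) (hv0 : ∀ x, v 0 x = 0) {c : ℝ} (hc : 0 < c) (t : ℝ)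
    (x : E3) (b : OrthonormalBasis (Fin 3) ℝ E3) :
    4 * Real.pi * v t x =
      (∫ θ in 0..Real.pi, ∫ φ in 0..2 * Real.pi,
        t * Real.sin θ * pt v 0 (x + (c * t) • sph b θ φ)) +
      ∫ ρ in 0..c * t, ∫ θ in 0..Real.pi, ∫ φ in 0..2 * Real.pi,
        (c⁻¹) ^ 2 * (ρ * Real.sin θ * box c v (t - c⁻¹ * ρ) (x + ρ • sph b θ φ)) := by
  obtain ⟨F, hF⟩ : ∃ F : ℝ × E3 → ℝ, F = fun p => v p.1 p.2 := ⟨_, rfl⟩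
  have hF1 : ∀ p, HasFDerivAt F (fderiv ℝ F p) p := by
    rw [hF]; exact fun p => (hv.differentiable p).hasFDerivAt
  have hF2 : ∀ p, HasFDerivAt (fderiv ℝ F) (fderiv ℝ (fderiv ℝ F) p) p := by
    rw [hF]; exact fun p => (hv.contDiff_fderiv.differentiable (by simp) p).hasFDerivAt
  have c2 : Continuous (fderiv ℝ (fderiv ℝ F)) := by
    rw [hF]; exact hv.contDiff_fderiv.continuous_fderiv (by simp)
  have key := cone_divergence hF1 hF2 c2 (by rw [hF]; exact fun p => hv.isSymmSndFDerivAt p) c t (c * t) x b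
  have e1 : ∀ ρ θ φ, (c⁻¹) ^ 2 * (ρ * Real.sin θ * box c v (t - c⁻¹ * ρ) (x + ρ • sph b θ φ)) =
      - (ρ * Real.sin θ * (∑ i, fderiv ℝ (fderiv ℝ F) (conePt c t x b ρ θ φ) (0, b i) (0, b i) -
      (c⁻¹) ^ 2 * fderiv ℝ (fderiv ℝ F) (conePt c t x b ρ θ φ) (1, 0) (1, 0))) := by
    intro ρ θ φ
    rw [box_eq hv c b, ← hF]
    change _ = -(_ * (∑ i, fderiv ℝ (fderiv ℝ F) (t - c⁻¹ * ρ, x + ρ • sph b θ φ) (0, b i) (0, b i) -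
      _ * fderiv ℝ (fderiv ℝ F) (t - c⁻¹ * ρ, x + ρ • sph b θ φ) (1, 0) (1, 0)))
    field_simp
    ring
  have e2 : ∀ y, F (0, y) = 0 := by rw [hF]; exact hv0
  have e3 : ∀ y w, fderiv ℝ F (0, y) (c⁻¹, w) = c⁻¹ * pt v 0 y := by
    intro y w
    have h1 : ((c⁻¹, w) : ℝ × E3) = c⁻¹ • ((1 : ℝ), (0 : E3)) + ContinuousLinearMap.inr ℝ ℝ E3 w := by
      simp
    have h2 : fderiv ℝ F (0, y) (ContinuousLinearMap.inr ℝ ℝ E3 w) = 0 := by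
      have h3 : HasFDerivAt (fun y : E3 => ((0 : ℝ), y)) (ContinuousLinearMap.inr ℝ ℝ E3) y :=
        hasFDerivAt_prodMk_right 0 y
      have h4 := (hF1 (0, y)).comp y h3
      have h5 : (F ∘ fun y : E3 => ((0 : ℝ), y)) = fun _ => 0 := by
        funext y; exact e2 y
      rw [h5] at h4
      have h6 := h4.unique (hasFDerivAt_const 0 y)
      exact congrArg (fun L : E3 →L[ℝ] ℝ => L w) h6
    rw [h1, map_add, h2, map_smul, pt_eq hv]
    simp [dd, ← hF]
  have e4 : ∀ θ φ, Real.sin θ * (F (conePt c t x b (c * t) θ φ) + c * t * fderiv ℝ F (conePt c t x b (c * t) θ φ) (c⁻¹, sph b θ φ)) -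
      Real.sin θ * (F (conePt c t x b 0 θ φ) + 0 * fderiv ℝ F (conePt c t x b 0 θ φ) (c⁻¹, sph b θ φ)) =
      t * Real.sin θ * pt v 0 (x + (c * t) • sph b θ φ) - Real.sin θ * v t x := by
    intro θ φ
    have h1 : conePt c t x b (c * t) θ φ = (0, x + (c * t) • sph b θ φ) := by
      simp only [conePt]; congr 1; field_simp; ring
    rw [h1, e2, e3]
    have h2 : F (conePt c t x b 0 θ φ) = v t x := by simp [conePt, hF]
    rw [h2]
    field_simp
    ring
  simp only [e1, intervalIntegral.integral_neg]
  simp only [e4] at key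
  rw [key]
  have e6 : ∀ θ, ∫ φ in 0..2 * Real.pi,
      (t * Real.sin θ * pt v 0 (x + (c * t) • sph b θ φ) - Real.sin θ * v t x) =
      (∫ φ in 0..2 * Real.pi, t * Real.sin θ * pt v 0 (x + (c * t) • sph b θ φ)) -
        2 * Real.pi * v t x * Real.sin θ := by
    intro θ
    have : Continuous fun φ => pt v 0 (x + (c * t) • sph b θ φ) :=
      hv.pt.continuous.comp (by fun_prop : Continuous fun φ => ((0 : ℝ), x + (c * t) • sph b θ φ))
    rw [intervalIntegral.integral_sub ((by fun_prop : Continuous _).intervalIntegrable _ _)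
      ((by fun_prop : Continuous _).intervalIntegrable _ _)]
    simp
    ring
  simp only [e6]
  have hc3 : Continuous fun p : ℝ × ℝ => t * Real.sin p.1 * pt v 0 (x + (c * t) • sph b p.1 p.2) := by
    have : Continuous fun p : ℝ × ℝ => pt v 0 (x + (c * t) • sph b p.1 p.2) :=
      hv.pt.continuous.comp
        (by fun_prop : Continuous fun p : ℝ × ℝ => ((0 : ℝ), x + (c * t) • sph b p.1 p.2))
    fun_prop
  rw [intervalIntegral.integral_sub ((continuous_integral
    (F := fun θ φ => t * Real.sin θ * pt v 0 (x + (c * t) • sph b θ φ)) hc3 _ _).intervalIntegrable _ _)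
      ((by fun_prop : Continuous _).intervalIntegrable _ _), intervalIntegral.integral_const_mul,
      integral_sin]
  simp
  ring

lemma inner_sph (b : OrthonormalBasis (Fin 3) ℝ E3) (θ φ : ℝ) :
    inner ℝ (b 2) (sph b θ φ) = Real.cos θ := by
  have h : ∀ i j, inner ℝ (b i) (b j) = if i = j then (1 : ℝ) else 0 :=
    fun i j => orthonormal_iff_ite.1 b.orthonormal i j
  simp [sph, inner_add_right, inner_smul_right, h]

lemma norm_sph (b : OrthonormalBasis (Fin 3) ℝ E3) (θ φ : ℝ) : ‖sph b θ φ‖ = 1 := by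
  have h : ∀ i j, inner ℝ (b i) (b j) = if i = j then (1 : ℝ) else 0 :=
    fun i j => orthonormal_iff_ite.1 b.orthonormal i j
  have h1 : ‖sph b θ φ‖ ^ 2 = 1 := by
    rw [← real_inner_self_eq_norm_sq]
    simp only [sph, inner_add_right, inner_smul_right, inner_add_left, real_inner_smul_left, h]
    simp only [show ((2 : Fin 3) = 0) = False by simp, show ((2 : Fin 3) = 1) = False by simp,
      show ((0 : Fin 3) = 2) = False by simp, show ((1 : Fin 3) = 2) = False by simp,
      show ((0 : Fin 3) = 1) = False by simp, show ((1 : Fin 3) = 0) = False by simp, if_true, if_false]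
    linear_combination Real.sin θ ^ 2 * Real.sin_sq_add_cos_sq φ + Real.sin_sq_add_cos_sq θ
  nlinarith [norm_nonneg (sph b θ φ)]

lemma norm_add_smul_sph {x : E3} (hx : x ≠ 0) {b : OrthonormalBasis (Fin 3) ℝ E3}
    (hb : b 2 = ‖x‖⁻¹ • x) (ρ θ φ : ℝ) :
    ‖x + ρ • sph b θ φ‖ = √(‖x‖ ^ 2 + ρ ^ 2 + 2 * ‖x‖ * ρ * Real.cos θ) := by
  have h0 : ‖x‖ ≠ 0 := norm_ne_zero_iff.2 hx
  have hx' : x = ‖x‖ • b 2 := by rw [hb, smul_smul, mul_inv_cancel₀ h0, one_smul]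
  have h1 : inner ℝ x (sph b θ φ) = ‖x‖ * Real.cos θ := by
    rw [← inner_sph b θ φ, ← real_inner_smul_left, ← hx']
  rw [← Real.sqrt_sq (norm_nonneg (x + ρ • sph b θ φ)), norm_add_sq_real, inner_smul_right, h1,
    norm_smul, norm_sph, mul_one, Real.norm_eq_abs, sq_abs]
  congr 1
  ring

/-- An integral over a sphere is controlled by an integral over the range of the distance to the
origin. -/
lemma abs_sphere_integral_le {x : E3} (hx : x ≠ 0) {b : OrthonormalBasis (Fin 3) ℝ E3}
    (hb : b 2 = ‖x‖⁻¹ • x) {ρ : ℝ} (hρ : 0 ≤ ρ) {g : E3 → ℝ} (hg : Continuous g) {k : ℝ → ℝ}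
    (hk : Continuous k) (hgk : ∀ y, ‖y - x‖ ≤ ρ → ‖y‖ * |g y| ≤ k ‖y‖) :
    |∫ θ in 0..Real.pi, ∫ φ in 0..2 * Real.pi, ρ * Real.sin θ * g (x + ρ • sph b θ φ)| ≤
      2 * Real.pi / ‖x‖ * ∫ s in |‖x‖ - ρ|..‖x‖ + ρ, k s := by
  rcases hρ.eq_or_lt with rfl | hρ
  · simp
  have hr : 0 < ‖x‖ := norm_pos_iff.2 hx
  set r := ‖x‖ with hr_def
  have hp := Real.pi_pos
  set P : ℝ → ℝ := fun θ => r ^ 2 + ρ ^ 2 + 2 * r * ρ * Real.cos θ with hP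
  have hH : ∀ s, HasDerivAt (fun s => ∫ u in 0..s, k u) (k s) s := fun s =>
    intervalIntegral.integral_hasDerivAt_right (hk.intervalIntegrable _ _)
      (hk.stronglyMeasurableAtFilter _ _) hk.continuousAt
  have cH : Continuous fun s => ∫ u in 0..s, k u :=
    continuous_iff_continuousAt.2 fun s => (hH s).continuousAt
  have cJ : Continuous fun θ => ∫ φ in 0..2 * Real.pi, ρ * Real.sin θ * g (x + ρ • sph b θ φ) := by
    refine continuous_integral (F := fun θ φ => ρ * Real.sin θ * g (x + ρ • sph b θ φ)) ?_ _ _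
    fun_prop
  refine (intervalIntegral.abs_integral_le_integral_abs hp.le).trans ?_
  refine (intervalIntegral.integral_le_sub_of_hasDeriv_right_of_le hp.le
    (g := fun θ => -(2 * Real.pi / r) * ∫ u in 0..√(P θ), k u)
    (g' := fun θ => -(2 * Real.pi / r) * (k √(P θ) * (-(2 * r * ρ * Real.sin θ) / (2 * √(P θ)))))
    ?_ ?_ ?_ ?_).trans (le_of_eq ?_)
  · exact (continuous_const.mul (cH.comp (by fun_prop : Continuous fun θ => √(P θ)))).continuousOn
  · intro θ hθ
    have h1 : 0 < P θ := by
      have : -1 < Real.cos θ := by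
        rw [← Real.cos_pi]
        exact Real.cos_lt_cos_of_nonneg_of_le_pi hθ.1.le le_rfl hθ.2
      have := mul_pos hr hρ
      simp only [hP]; nlinarith [sq_nonneg (r - ρ)]
    have h2 : HasDerivAt P (-(2 * r * ρ * Real.sin θ)) θ :=
      (((Real.hasDerivAt_cos θ).const_mul (2 * r * ρ)).const_add _).congr_deriv (by ring)
    exact (((hH _).comp θ (h2.sqrt h1.ne')).const_mul _).hasDerivWithinAt
  · exact cJ.abs.continuousOn.integrableOn_compact isCompact_Icc
  · intro θ hθ
    have h1 : 0 < P θ := by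
      have : -1 < Real.cos θ := by
        rw [← Real.cos_pi]
        exact Real.cos_lt_cos_of_nonneg_of_le_pi hθ.1.le le_rfl hθ.2
      have := mul_pos hr hρ
      simp only [hP]; nlinarith [sq_nonneg (r - ρ)]
    have h3 : 0 < √(P θ) := Real.sqrt_pos.2 h1
    have hs : 0 < Real.sin θ := Real.sin_pos_of_pos_of_lt_pi hθ.1 hθ.2
    have h4 := intervalIntegral.norm_integral_le_of_norm_le_const (a := 0) (b := 2 * Real.pi)
      (C := ρ * Real.sin θ * (k √(P θ) / √(P θ)))
      (f := fun φ => ρ * Real.sin θ * g (x + ρ • sph b θ φ)) (by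
        intro φ _
        have h5 := hgk (x + ρ • sph b θ φ) (by simp [norm_smul, norm_sph, abs_of_pos hρ])
        rw [norm_add_smul_sph hx hb] at h5
        rw [Real.norm_eq_abs, abs_mul, abs_of_pos (mul_pos hρ hs)]
        gcongr
        rw [le_div_iff₀ h3, mul_comm]
        exact h5)
    refine h4.trans (le_of_eq ?_)
    rw [sub_zero, abs_of_pos (by positivity)]
    field_simp
  · have e0 : √(P 0) = r + ρ := by
      rw [show P 0 = (r + ρ) ^ 2 by simp [hP]; ring]
      exact Real.sqrt_sq (by positivity)
    have e1 : √(P Real.pi) = |r - ρ| := by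
      rw [show P Real.pi = (r - ρ) ^ 2 by simp [hP]; ring]
      exact Real.sqrt_sq_eq_abs _
    simp only [e0, e1]
    rw [← intervalIntegral.integral_add_adjacent_intervals (hk.intervalIntegrable 0 |r - ρ|)
      (hk.intervalIntegrable |r - ρ| (r + ρ))]
    ring

/-- The weight integral appearing in the pointwise bounds. -/
def wInt (κ q R : ℝ) : ℝ := ∫ p in q..R, (1 + |p|) ^ (-κ)

lemma continuous_one_add_abs_rpow (κ : ℝ) : Continuous fun p : ℝ => (1 + |p|) ^ κ :=
  (by fun_prop : Continuous fun p : ℝ => 1 + |p|).rpow_const fun p => Or.inl (by positivity)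

lemma abs_data_integral_le {c t κ B : ℝ} (hc : 0 < c) (ht : 0 ≤ t) {x : E3} (hx : x ≠ 0)
    {b : OrthonormalBasis (Fin 3) ℝ E3} (hb : b 2 = ‖x‖⁻¹ • x) {g : E3 → ℝ} (hg : Continuous g)
    (hB : ∀ y, ‖y - x‖ ≤ c * t → ‖y‖ * |g y| ≤ B * (1 + ‖y‖) ^ (-κ)) :
    |∫ θ in 0..Real.pi, ∫ φ in 0..2 * Real.pi, t * Real.sin θ * g (x + (c * t) • sph b θ φ)| ≤
      c⁻¹ * (2 * Real.pi / ‖x‖ * (B * wInt κ |c * t - ‖x‖| (c * t + ‖x‖))) := by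
  have h := abs_sphere_integral_le hx hb (mul_nonneg hc.le ht) hg
    (k := fun p => B * (1 + |p|) ^ (-κ)) (continuous_const.mul (continuous_one_add_abs_rpow (-κ)))
    (fun y hy => by simpa using hB y hy)
  rw [intervalIntegral.integral_const_mul, abs_sub_comm ‖x‖, add_comm ‖x‖] at h
  have e : ∀ θ φ, t * Real.sin θ * g (x + (c * t) • sph b θ φ) =
      c⁻¹ * (c * t * Real.sin θ * g (x + (c * t) • sph b θ φ)) := by
    intro θ φ; field_simp
  simp only [e, intervalIntegral.integral_const_mul, abs_mul, abs_of_pos (inv_pos.2 hc)]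
  gcongr
  simpa only [intervalIntegral.integral_const_mul, wInt] using h

lemma abs_source_integral_le {c t κ B K : ℝ} (hc : 0 < c) (ht : 0 ≤ t) (hB0 : 0 ≤ B) {x : E3}
    (hx : x ≠ 0) {b : OrthonormalBasis (Fin 3) ℝ E3} (hb : b 2 = ‖x‖⁻¹ • x) {g : Fn}
    (hg : Continuous fun p : ℝ × E3 => g p.1 p.2) {S : ℝ → ℝ → ℝ}
    (hS : Continuous fun p : ℝ × ℝ => S p.1 p.2) (hS0 : ∀ τ s, 0 ≤ S τ s)
    (hSK : ∀ R T, 0 ≤ T → ∫ τ in 0..T, S τ (R - c * τ) ≤ K)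
    (hB : ∀ τ y, 0 ≤ τ → τ ≤ t → ‖y - x‖ ≤ c * (t - τ) →
      ‖y‖ * |g τ y| ≤ B * ((1 + |c * τ + ‖y‖|) ^ (-κ) * S τ ‖y‖)) :
    |∫ ρ in 0..c * t, ∫ θ in 0..Real.pi, ∫ φ in 0..2 * Real.pi,
        (c⁻¹) ^ 2 * (ρ * Real.sin θ * g (t - c⁻¹ * ρ) (x + ρ • sph b θ φ))| ≤
      c⁻¹ * (2 * Real.pi / ‖x‖ * (B * K * wInt κ |c * t - ‖x‖| (c * t + ‖x‖))) := by
  have hr : 0 < ‖x‖ := norm_pos_iff.2 hx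
  have hct := mul_nonneg hc.le ht
  set r := ‖x‖ with hr_def
  set q := |c * t - r| with hq
  have hqR : q ≤ c * t + r := abs_le.2 ⟨by linarith, by linarith⟩
  have cw := continuous_one_add_abs_rpow (-κ)
  set Φ : ℝ → ℝ → ℝ := fun ρ p => (1 + |p|) ^ (-κ) * S (t - c⁻¹ * ρ) (p - (c * t - ρ)) with hΦ
  have cΦ : Continuous fun p : ℝ × ℝ => Φ p.1 p.2 := by
    have h1 : Continuous fun p : ℝ × ℝ => S (t - c⁻¹ * p.1) (p.2 - (c * t - p.1)) :=
      hS.comp (by fun_prop : Continuous fun p : ℝ × ℝ => (t - c⁻¹ * p.1, p.2 - (c * t - p.1)))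
    exact (cw.comp continuous_snd).mul h1
  have hΦ0 : ∀ ρ p, 0 ≤ Φ ρ p := fun ρ p => mul_nonneg (by positivity) (hS0 _ _)
  have main : ∀ ρ ∈ Set.Ioc 0 (c * t), ‖∫ θ in 0..Real.pi, ∫ φ in 0..2 * Real.pi,
        (c⁻¹) ^ 2 * (ρ * Real.sin θ * g (t - c⁻¹ * ρ) (x + ρ • sph b θ φ))‖ ≤
      (c⁻¹) ^ 2 * (2 * Real.pi / r) * B * ∫ p in q..c * t + r, Φ ρ p := by
    intro ρ hρ
    have hτ : c * (t - c⁻¹ * ρ) = c * t - ρ := by field_simp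
    have hρt : c⁻¹ * ρ ≤ t := by rw [inv_mul_le_iff₀ hc]; exact hρ.2
    have h1 := abs_sphere_integral_le hx hb hρ.1.le (g := g (t - c⁻¹ * ρ))
      (hg.comp (by fun_prop : Continuous fun y : E3 => (t - c⁻¹ * ρ, y)))
      (k := fun s => B * Φ ρ (s + (c * t - ρ)))
      (continuous_const.mul (cΦ.comp (by fun_prop : Continuous fun s : ℝ => (ρ, s + (c * t - ρ)))))
      (by
        intro y hy
        have := hB (t - c⁻¹ * ρ) y (by linarith)
          (by have := mul_nonneg (inv_nonneg.2 hc.le) hρ.1.le; linarith)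
          (by rw [show c * (t - (t - c⁻¹ * ρ)) = ρ by field_simp; ring]; exact hy)
        simp only [hΦ, add_sub_cancel_right]
        rwa [hτ, add_comm (c * t - ρ)] at this)
    rw [intervalIntegral.integral_const_mul, intervalIntegral.integral_comp_add_right (Φ ρ),
      ← hr_def] at h1
    have h2 : ∫ p in |r - ρ| + (c * t - ρ)..r + ρ + (c * t - ρ), Φ ρ p ≤
        ∫ p in q..c * t + r, Φ ρ p := by
      have e : r + ρ + (c * t - ρ) = c * t + r := by ring
      rw [e]
      have cc : Continuous (Φ ρ) := cΦ.comp (by fun_prop : Continuous fun s : ℝ => (ρ, s))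
      refine intervalIntegral.integral_mono_interval ?_ ?_ le_rfl
        (Filter.Eventually.of_forall (hΦ0 ρ)) (cc.intervalIntegrable _ _)
      · rw [hq]
        have h3 := abs_sub_le (c * t) ρ r
        rw [abs_of_nonneg (sub_nonneg.2 hρ.2), abs_sub_comm ρ r] at h3
        linarith
      · have : |r - ρ| ≤ r + ρ := abs_le.2 ⟨by linarith [hρ.1], by linarith [hρ.1]⟩
        linarith
    simp only [intervalIntegral.integral_const_mul, norm_mul, norm_pow, norm_inv, Real.norm_eq_abs,
      abs_of_pos hc]
    have h4 : 0 ≤ 2 * Real.pi / r := by positivity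
    calc _ ≤ c⁻¹ ^ 2 * (2 * Real.pi / r * (B * ∫ p in |r - ρ| + (c * t - ρ)..r + ρ + (c * t - ρ), Φ ρ p)) := by
          gcongr
          simpa only [intervalIntegral.integral_const_mul] using h1
      _ ≤ c⁻¹ ^ 2 * (2 * Real.pi / r * (B * ∫ p in q..c * t + r, Φ ρ p)) := by gcongr
      _ = _ := by ring
  have h5 := intervalIntegral.norm_integral_le_of_norm_le (μ := volume) hct (Filter.Eventually.of_forall main)
    ((continuous_const.mul (continuous_integral cΦ _ _)).intervalIntegrable _ _)
  rw [Real.norm_eq_abs] at h5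
  refine h5.trans ?_
  rw [intervalIntegral.integral_const_mul, intervalIntegral_swap_of_continuous cΦ]
  have h6 : ∫ p in q..c * t + r, ∫ ρ in 0..c * t, Φ ρ p ≤
      ∫ p in q..c * t + r, (c * K) * (1 + |p|) ^ (-κ) := by
    refine intervalIntegral.integral_mono_on hqR ?_ ?_ ?_
    · exact (continuous_integral (F := fun p ρ => Φ ρ p) (cΦ.comp continuous_swap) _ _).intervalIntegrable _ _
    · exact (continuous_const.mul cw).intervalIntegrable _ _
    · intro p _
      have e : ∀ ρ, Φ ρ p = (1 + |p|) ^ (-κ) *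
          (fun τ => S τ (p - c * τ)) (t - c⁻¹ * ρ) := by
        intro ρ
        have : c * (t - c⁻¹ * ρ) = c * t - ρ := by field_simp
        simp only [hΦ, this]
      simp only [e]
      rw [intervalIntegral.integral_const_mul, mul_comm (c * K)]
      gcongr
      rw [intervalIntegral.integral_comp_sub_mul (fun τ => S τ (p - c * τ)) (inv_ne_zero hc.ne')]
      rw [inv_inv, smul_eq_mul, mul_zero, sub_zero, inv_mul_cancel_left₀ hc.ne', sub_self]
      gcongr
      exact hSK p t ht
  rw [intervalIntegral.integral_const_mul] at h6
  calc _ ≤ c⁻¹ ^ 2 * (2 * Real.pi / r) * B * (c * K * ∫ p in q..c * t + r, (1 + |p|) ^ (-κ)) := by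
        gcongr
    _ = _ := by
        unfold wInt
        field_simp

/-- Pointwise bound for a wave vanishing at the initial time. -/
lemma abs_le_of_wave {c t κ B K M : ℝ} (hc : 0 < c) (ht : 0 ≤ t) (hB0 : 0 ≤ B) {x : E3}
    (hx : x ≠ 0) {v : Fn} (hv : Smooth v) (hv0 : ∀ x, v 0 x = 0) {S : ℝ → ℝ → ℝ}
    (hS : Continuous fun p : ℝ × ℝ => S p.1 p.2) (hS0 : ∀ τ s, 0 ≤ S τ s)
    (hSK : ∀ R T, 0 ≤ T → ∫ τ in 0..T, S τ (R - c * τ) ≤ K)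
    (hB : ∀ τ y, 0 ≤ τ → τ ≤ t → ‖y - x‖ ≤ c * (t - τ) →
      ‖y‖ * |box c v τ y| ≤ B * ((1 + |c * τ + ‖y‖|) ^ (-κ) * S τ ‖y‖))
    (hM : ∀ y, ‖y - x‖ ≤ c * t → ‖y‖ * |pt v 0 y| ≤ M * (1 + ‖y‖) ^ (-κ)) :
    |v t x| ≤ (2 * c)⁻¹ * (M + B * K) * (wInt κ |c * t - ‖x‖| (c * t + ‖x‖) / ‖x‖) := by
  have hr : 0 < ‖x‖ := norm_pos_iff.2 hx
  obtain ⟨b, hb⟩ := exists_orthonormalBasis_third (w := ‖x‖⁻¹ • x) (by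
    rw [norm_smul, norm_inv, norm_norm, inv_mul_cancel₀ hr.ne'])
  have h1 := kirchhoff hv hv0 hc t x b
  have h2 := abs_data_integral_le hc ht hx hb
    (hv.pt.continuous.comp (by fun_prop : Continuous fun y : E3 => ((0 : ℝ), y))) hM
  have h3 := abs_source_integral_le hc ht hB0 hx hb (hv.box c).continuous hS hS0 hSK hB
  have hp := Real.pi_pos
  have h4 := (abs_add_le _ _).trans (add_le_add h2 h3)
  simp only [Function.comp_apply] at h4
  rw [← h1, abs_mul, abs_of_pos (by positivity : 0 < 4 * Real.pi)] at h4
  rw [← le_div_iff₀' (by positivity)] at h4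
  refine h4.trans (le_of_eq ?_)
  field_simp
  ring

lemma wInt_le_of_two {κ q R : ℝ} (hκ2 : κ ≤ 2) (hq : 0 ≤ q) (hqR : q ≤ R) :
    wInt κ q R ≤ (R - q) * ((1 + R) ^ (1 - κ) / (1 + q)) := by
  have h := intervalIntegral.integral_le_sub_of_hasDeriv_right_of_le hqR
    (g := fun p => (1 + R) ^ (2 - κ) * -(1 + p)⁻¹) (φ := fun p => (1 + |p|) ^ (-κ))
    (g' := fun p => (1 + R) ^ (2 - κ) * ((1 + p) ^ 2)⁻¹)
    (by
      refine continuousOn_const.mul (ContinuousOn.neg (ContinuousOn.inv₀ (by fun_prop) ?_))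
      intro p hp
      have : 0 < 1 + p := by linarith [hp.1]
      exact this.ne')
    (by
      intro p hp
      have hp0 : 1 + p ≠ 0 := by linarith [hp.1]
      have := (((hasDerivAt_id p).const_add 1).inv hp0).neg.const_mul ((1 + R) ^ (2 - κ))
      refine (this.congr_deriv ?_).hasDerivWithinAt
      simp [neg_div])
    ((continuous_one_add_abs_rpow (-κ)).continuousOn.integrableOn_compact isCompact_Icc)
    (by
      intro p hp
      have hp0 : 0 < 1 + p := by linarith [hp.1]
      rw [abs_of_nonneg (by linarith [hp.1])]
      have : (1 + p) ^ (-κ) = (1 + p) ^ (2 - κ) * ((1 + p) ^ 2)⁻¹ := by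
        rw [← Real.rpow_natCast, ← Real.rpow_neg hp0.le, ← Real.rpow_add hp0]
        congr 1
        push_cast; ring
      rw [this]
      gcongr
      exact hp.2.le)
  refine h.trans (le_of_eq ?_)
  have hR0 : 0 < 1 + R := by linarith
  have hq0 : 0 < 1 + q := by linarith
  have : (1 + R) ^ (2 - κ) = (1 + R) ^ (1 - κ) * (1 + R) := by
    rw [← Real.rpow_add_one hR0.ne']; congr 1; ring
  rw [this]
  field_simp
  ring

lemma wInt_le_log {κ q R : ℝ} (hκ1 : 1 ≤ κ) (hq : 0 ≤ q) (hqR : q ≤ R) :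
    wInt κ q R ≤ (1 + q) ^ (1 - κ) * (Real.log (1 + R) - Real.log (1 + q)) := by
  have h := intervalIntegral.integral_le_sub_of_hasDeriv_right_of_le hqR
    (g := fun p => (1 + q) ^ (1 - κ) * Real.log (1 + p)) (φ := fun p => (1 + |p|) ^ (-κ))
    (g' := fun p => (1 + q) ^ (1 - κ) * (1 + p)⁻¹)
    (by
      refine continuousOn_const.mul (ContinuousOn.log (by fun_prop) ?_)
      intro p hp
      have : 0 < 1 + p := by linarith [hp.1]
      exact this.ne')
    (by
      intro p hp
      have hp0 : 1 + p ≠ 0 := by linarith [hp.1]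
      have := (((hasDerivAt_id p).const_add 1).log hp0).const_mul ((1 + q) ^ (1 - κ))
      refine (this.congr_deriv ?_).hasDerivWithinAt
      simp)
    ((continuous_one_add_abs_rpow (-κ)).continuousOn.integrableOn_compact isCompact_Icc)
    (by
      intro p hp
      have hp0 : 0 < 1 + p := by linarith [hp.1]
      rw [abs_of_nonneg (by linarith [hp.1])]
      have : (1 + p) ^ (-κ) = (1 + p) ^ (1 - κ) * (1 + p)⁻¹ := by
        rw [← Real.rpow_neg_one, ← Real.rpow_add hp0]
        congr 1
        ring
      rw [this]
      gcongr ?_ * _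
      exact Real.rpow_le_rpow_of_nonpos (by linarith) (by linarith [hp.1]) (by linarith))
  refine h.trans (le_of_eq ?_)
  ring

lemma wInt_div_le_of_two {κ q R r : ℝ} (hκ2 : κ ≤ 2) (hq : 0 ≤ q) (hqR : q ≤ R) (hr : 0 < r)
    (hRq : R - q ≤ 2 * r) : wInt κ q R / r ≤ 2 * ((1 + R) ^ (1 - κ) / (1 + q)) := by
  rw [div_le_iff₀ hr]
  refine (wInt_le_of_two hκ2 hq hqR).trans ?_
  have : 0 ≤ (1 + R) ^ (1 - κ) / (1 + q) := by
    have : 0 ≤ R := hq.trans hqR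
    positivity
  nlinarith

lemma wInt_div_le_log {κ q R r : ℝ} (hκ1 : 1 ≤ κ) (hq : 0 ≤ q) (hqR : q ≤ R) (hr : 0 < r)
    (hRq : R - q ≤ 2 * r) :
    wInt κ q R / r ≤ (1 + q) ^ (1 - κ) * (1 + R)⁻¹ * (2 * Real.log (1 + R) + 2) := by
  have hq1 : 0 < 1 + q := by linarith
  have hR1 : 0 < 1 + R := by linarith
  have h1 : Real.log (1 + R) - Real.log (1 + q) = Real.log ((1 + R) / (1 + q)) :=
    (Real.log_div hR1.ne' hq1.ne').symm
  have h2 := Real.log_le_sub_one_of_pos (div_pos hR1 hq1)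
  rw [← h1, div_sub_one hq1.ne', le_div_iff₀ hq1] at h2
  have h3 : 0 ≤ Real.log (1 + q) := Real.log_nonneg (by linarith)
  have h4 : Real.log (1 + q) ≤ Real.log (1 + R) := Real.log_le_log hq1 (by linarith)
  have h5 : 0 ≤ (1 + q) ^ (1 - κ) := by positivity
  have h6 : Real.log (1 + R) - Real.log (1 + q) ≤ (1 + R)⁻¹ * (2 * Real.log (1 + R) + 2) * r := by
    rw [mul_assoc, ← div_eq_inv_mul, le_div_iff₀ hR1]
    nlinarith
  rw [div_le_iff₀ hr]
  refine (wInt_le_log hκ1 hq hqR).trans ?_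
  calc _ ≤ (1 + q) ^ (1 - κ) * ((1 + R)⁻¹ * (2 * Real.log (1 + R) + 2) * r) := by gcongr
    _ = _ := by ring

lemma dd_space {f : Fn} (hf : Smooth f) (y : E3) :
    dd (0, y) f = fun t x => ∑ j, y j * pd j f t x := by
  funext t x
  have h : ((0 : ℝ), y) = ∑ j, y j • ((0 : ℝ), (EuclideanSpace.single j 1 : E3)) := by
    have h1 := (EuclideanSpace.basisFun (Fin 3) ℝ).sum_repr y
    simp only [EuclideanSpace.basisFun_apply, EuclideanSpace.basisFun_repr] at h1
    rw [Prod.ext_iff]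
    constructor
    · simp [Prod.fst_sum]
    · rw [Prod.snd_sum]; exact h1.symm
  unfold dd
  rw [h, map_sum]
  refine Finset.sum_congr rfl fun j _ => ?_
  rw [map_smul, pd_eq hf]
  rfl

/-- The sum of the squares of the rotation fields, i.e. the Laplacian of the unit sphere. -/
def sphLap (f : Fn) : Fn := fun t x =>
  rotA 0 1 (rotA 0 1 f) t x + rotA 0 2 (rotA 0 2 f) t x + rotA 1 2 (rotA 1 2 f) t x

lemma rotA_rotA {f : Fn} (hf : Smooth f) {j k : Fin 3} (hjk : j ≠ k) (t : ℝ) (x : E3) :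
    rotA j k (rotA j k f) t x = x j ^ 2 * pd k (pd k f) t x + x k ^ 2 * pd j (pd j f) t x -
      2 * (x j * x k * pd j (pd k f) t x) - x j * pd j f t x - x k * pd k f t x := by
  have e : rotA j k (rotA j k f) t x = x j * pd k (rotA j k f) t x - x k * pd j (rotA j k f) t x := rfl
  rw [e, pd_rotA hf, pd_rotA hf]
  simp only [hjk, hjk.symm, if_true, if_false, rotA, pd_comm hf k j]
  ring

lemma sq_norm_mul_lap {f : Fn} (hf : Smooth f) (t : ℝ) (x : E3) :
    ‖x‖ ^ 2 * ∑ j, pd j (pd j f) t x =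
      dd (0, x) (dd (0, x) f) t x + 2 * dd (0, x) f t x + sphLap f t x := by
  have h1 : dd (0, x) (dd (0, x) f) t x = ∑ j, x j * ∑ k, x k * pd j (pd k f) t x := by
    rw [dd_space (hf.dd _), dd_space hf]
    refine Finset.sum_congr rfl fun j _ => ?_
    congr 1
    change fderiv ℝ (fun z => ∑ k, x k * pd k f t z) x _ = _
    rw [fderiv_fun_sum fun k _ => ((hf.pd k).differentiable_slice t x).const_mul _,
      _root_.sum_apply]
    refine Finset.sum_congr rfl fun k _ => ?_
    rw [fderiv_const_mul ((hf.pd k).differentiable_slice t x)]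
    rfl
  rw [h1, dd_space hf, EuclideanSpace.norm_sq_eq]
  unfold sphLap
  rw [rotA_rotA hf (by decide), rotA_rotA hf (by decide), rotA_rotA hf (by decide)]
  simp only [Fin.sum_univ_three, Real.norm_eq_abs, sq_abs, pd_comm hf 1 0, pd_comm hf 2 0,
    pd_comm hf 2 1]
  ring

lemma Smooth.sphLap {f : Fn} (hf : Smooth f) : Smooth (sphLap f) :=
  (((hf.rotA 0 1).rotA 0 1).add ((hf.rotA 0 2).rotA 0 2)).add ((hf.rotA 1 2).rotA 1 2)

/-- The derivative of `λ D₊u + c u` along an incoming characteristic ray. -/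
lemma hasDerivAt_ray {f : Fn} (hf : Smooth f) (c ℓ : ℝ) {w : E3} (hw : ‖w‖ = 1) (s : ℝ)
    (hs : ℓ - c * s ≠ 0) :
    HasDerivAt (fun s => (ℓ - c * s) * dd (1, c • w) f s ((ℓ - c * s) • w) +
        c * f s ((ℓ - c * s) • w))
      ((ℓ - c * s) * box c f s ((ℓ - c * s) • w) +
        c ^ 2 * ((ℓ - c * s)⁻¹ * sphLap f s ((ℓ - c * s) • w))) s := by
  have hz : HasDerivAt (fun s => (s, (ℓ - c * s) • w)) ((1 : ℝ), -c • w) s := by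
    refine (hasDerivAt_id s).prodMk ?_
    have := (((hasDerivAt_id s).const_mul c).const_sub ℓ).smul_const w
    simpa using this
  have hl : HasDerivAt (fun s => ℓ - c * s) (-c) s := by
    simpa using ((hasDerivAt_id s).const_mul c).const_sub ℓ
  have h1 := ((hf.differentiable (s, (ℓ - c * s) • w)).hasFDerivAt).comp_hasDerivAt s hz
  have h2 := (((hf.dd (1, c • w)).differentiable (s, (ℓ - c * s) • w)).hasFDerivAt).comp_hasDerivAt s hz
  have h3 := (hl.mul h2).add (h1.const_mul c)
  refine h3.congr_deriv ?_
  set l := ℓ - c * s with hl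
  set y := l • w with hy
  have hyl : ‖y‖ ^ 2 = l ^ 2 := by rw [hy, norm_smul, hw, mul_one, Real.norm_eq_abs, sq_abs]
  have e1 := sq_norm_mul_lap hf s y
  have e2 := dd_dd hf (1, -c • w) (1, c • w) s y
  have e3 : box c f s y = dd (1, 0) (dd (1, 0) f) s y - c ^ 2 * ∑ j, pd j (pd j f) s y := by
    unfold box; rw [pt_eq hf.pt, pt_eq hf]
  rw [dd_dd hf] at e1 e3
  have d1 : ((1 : ℝ), c • w) = (1, 0) + c • ((0 : ℝ), w) := by simp
  have d2 : ((1 : ℝ), -c • w) = (1, 0) - c • ((0 : ℝ), w) := by simp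
  have d3 : ((0 : ℝ), y) = l • ((0 : ℝ), w) := by simp [hy]
  have sy := hf.isSymmSndFDerivAt (s, y) (1, 0) (0, w)
  change -c * dd (1, c • w) f s y + l * dd (1, -c • w) (dd (1, c • w) f) s y +
    c * dd (1, -c • w) f s y = _
  rw [e2]
  unfold dd at e1 ⊢
  rw [d3] at e1
  rw [hyl] at e1
  rw [e3, d1, d2]
  simp only [map_add, map_sub, map_smul, _root_.sub_apply, _root_.smul_apply,
    smul_eq_mul] at e1 ⊢
  rw [sy]
  rw [eq_sub_of_add_eq' e1.symm]
  field_simp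
  ring

lemma dd_ray_eq {f : Fn} (hf : Smooth f) (c : ℝ) (w : E3) (t : ℝ) (x : E3) :
    dd (1, c • w) f t x = pt f t x + c * ∑ j, w j * pd j f t x := by
  have d1 : ((1 : ℝ), c • w) = (1, 0) + c • ((0 : ℝ), w) := by simp
  rw [pt_eq hf]
  have := congrFun (congrFun (dd_space hf w) t) x
  rw [← this]
  unfold dd
  rw [d1, map_add, map_smul, smul_eq_mul]

lemma pd_zero_of_zero {f : Fn} {t : ℝ} (h : ∀ x, f t x = 0) (j : Fin 3) (x : E3) :
    pd j f t x = 0 := by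
  have : f t = fun _ => 0 := funext h
  unfold pd
  rw [this]; simp

lemma rotA_zero_of_zero {f : Fn} {t : ℝ} (h : ∀ x, f t x = 0) (j k : Fin 3) (x : E3) :
    rotA j k f t x = 0 := by
  unfold rotA
  rw [pd_zero_of_zero h, pd_zero_of_zero h]; simp

/-- The outgoing derivative of a wave with zero data, as an integral along the incoming ray. -/
lemma ray_identity {f : Fn} (hf : Smooth f) (h0 : ∀ x, f 0 x = 0) (h1 : ∀ x, pt f 0 x = 0)
    {c t : ℝ} (hc : 0 < c) (ht : 0 ≤ t) {x : E3} (hx : x ≠ 0) :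
    ‖x‖ * Dp c f t x + c * f t x = ∫ s in 0..t,
      ((‖x‖ + c * t - c * s) * box c f s ((‖x‖ + c * t - c * s) • ‖x‖⁻¹ • x) +
        c ^ 2 * ((‖x‖ + c * t - c * s)⁻¹ * sphLap f s ((‖x‖ + c * t - c * s) • ‖x‖⁻¹ • x))) := by
  have hr : 0 < ‖x‖ := norm_pos_iff.2 hx
  have hw : ‖‖x‖⁻¹ • x‖ = 1 := by rw [norm_smul, norm_inv, norm_norm, inv_mul_cancel₀ hr.ne']
  have hpos : ∀ s ∈ Set.uIcc 0 t, ‖x‖ + c * t - c * s ≠ 0 := by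
    intro s hs
    rw [Set.uIcc_of_le ht] at hs
    have := mul_le_mul_of_nonneg_left hs.2 hc.le
    exact ne_of_gt (by linarith)
  have cy : Continuous fun s : ℝ => (s, (‖x‖ + c * t - c * s) • ‖x‖⁻¹ • x) := by fun_prop
  rw [intervalIntegral.integral_eq_sub_of_hasDerivAt
    (fun s hs => hasDerivAt_ray hf c (‖x‖ + c * t) hw s (hpos s hs))]
  · simp only [dd_ray_eq hf, h0, h1, pd_zero_of_zero h0]
    rw [add_sub_cancel_right, smul_smul, mul_inv_cancel₀ hr.ne', one_smul]
    simp only [Dp, pr, PiLp.smul_apply, smul_eq_mul, div_eq_inv_mul]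
    simp
  · refine ContinuousOn.intervalIntegrable ?_
    refine ContinuousOn.add (Continuous.continuousOn ?_) (continuousOn_const.mul
      (ContinuousOn.mul (ContinuousOn.inv₀ (by fun_prop) hpos) (Continuous.continuousOn ?_)))
    · exact (by fun_prop : Continuous fun s : ℝ => ‖x‖ + c * t - c * s).mul
        ((hf.box c).continuous.comp cy)
    · exact hf.sphLap.continuous.comp cy

/-- A weighted bound for `h` on the backward cone with vertex `(t, x)`. -/
def ConeBound (c κ B : ℝ) (S : ℝ → ℝ → ℝ) (t : ℝ) (x : E3) (h : Fn) : Prop :=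
  ∀ τ y, 0 ≤ τ → τ ≤ t → ‖y - x‖ ≤ c * (t - τ) →
    ‖y‖ * |h τ y| ≤ B * ((1 + |c * τ + ‖y‖|) ^ (-κ) * S τ ‖y‖)

lemma ConeBound.mono {c κ B : ℝ} {S : ℝ → ℝ → ℝ} {t s : ℝ} {x y : E3} {h : Fn}
    (H : ConeBound c κ B S t x h) (hst : s ≤ t) (hyx : ‖y - x‖ ≤ c * (t - s)) :
    ConeBound c κ B S s y h := fun τ z h1 h2 h3 => by
  refine H τ z h1 (h2.trans hst) ?_
  have := norm_sub_le_norm_sub_add_norm_sub z y x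
  linarith

/-- The hypotheses on the weight `S`: continuity, nonnegativity, and boundedness by `K` of its
integrals along incoming rays. -/
structure RayWeight (c K : ℝ) (S : ℝ → ℝ → ℝ) : Prop where
  continuous : Continuous fun p : ℝ × ℝ => S p.1 p.2
  nonneg : ∀ τ s, 0 ≤ S τ s
  integral_le : ∀ R T, 0 ≤ T → ∫ τ in 0..T, S τ (R - c * τ) ≤ K

lemma abs_wave_le_of_two {c t κ B K : ℝ} {S : ℝ → ℝ → ℝ} (hS : RayWeight c K S) (hc : 0 < c)
    (ht : 0 ≤ t) (hκ2 : κ ≤ 2) (hB0 : 0 ≤ B) (hK : 0 ≤ K) {x : E3} (hx : x ≠ 0) {v : Fn}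
    (hv : Smooth v) (hv0 : ∀ x, v 0 x = 0) (hv1 : ∀ x, pt v 0 x = 0)
    (hB : ConeBound c κ B S t x (box c v)) :
    |v t x| ≤ c⁻¹ * B * K * ((1 + (c * t + ‖x‖)) ^ (1 - κ) / (1 + |c * t - ‖x‖|)) := by
  have hr : 0 < ‖x‖ := norm_pos_iff.2 hx
  have hct := mul_nonneg hc.le ht
  have h1 := abs_le_of_wave (M := 0) hc ht hB0 hx hv hv0 hS.1 hS.2 hS.3 hB (by simp [hv1])
  have h2 := wInt_div_le_of_two hκ2 (abs_nonneg (c * t - ‖x‖))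
    (abs_le.2 ⟨by linarith, by linarith⟩ : _ ≤ c * t + ‖x‖) hr
    (by linarith [le_abs_self (c * t - ‖x‖)])
  calc _ ≤ _ := h1
    _ ≤ (2 * c)⁻¹ * (0 + B * K) * (2 * ((1 + (c * t + ‖x‖)) ^ (1 - κ) / (1 + |c * t - ‖x‖|))) := by
      gcongr
    _ = _ := by field_simp; ring

lemma abs_wave_le_log {c t κ B K M : ℝ} {S : ℝ → ℝ → ℝ} (hS : RayWeight c K S) (hc : 0 < c)
    (ht : 0 ≤ t) (hκ1 : 1 ≤ κ) (hB0 : 0 ≤ B) (hK : 0 ≤ K) (hM0 : 0 ≤ M) {x : E3} (hx : x ≠ 0)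
    {v : Fn} (hv : Smooth v) (hv0 : ∀ x, v 0 x = 0) (hB : ConeBound c κ B S t x (box c v))
    (hM : ∀ y, ‖y - x‖ ≤ c * t → ‖y‖ * |pt v 0 y| ≤ M * (1 + ‖y‖) ^ (-κ)) :
    |v t x| ≤ c⁻¹ * (M + B * K) * ((1 + |c * t - ‖x‖|) ^ (1 - κ) * (1 + (c * t + ‖x‖))⁻¹ *
      (1 + Real.log (1 + (c * t + ‖x‖)))) := by
  have hr : 0 < ‖x‖ := norm_pos_iff.2 hx
  have hct := mul_nonneg hc.le ht
  have h1 := abs_le_of_wave hc ht hB0 hx hv hv0 hS.1 hS.2 hS.3 hB hM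
  have h2 := wInt_div_le_log hκ1 (abs_nonneg (c * t - ‖x‖))
    (abs_le.2 ⟨by linarith, by linarith⟩ : _ ≤ c * t + ‖x‖) hr
    (by linarith [le_abs_self (c * t - ‖x‖)])
  calc _ ≤ _ := h1
    _ ≤ (2 * c)⁻¹ * (M + B * K) * ((1 + |c * t - ‖x‖|) ^ (1 - κ) * (1 + (c * t + ‖x‖))⁻¹ *
      (2 * Real.log (1 + (c * t + ‖x‖)) + 2)) := by gcongr
    _ = _ := by field_simp; ring

lemma box_eq_pt_pt_of_zero {v : Fn} (hv0 : ∀ x, v 0 x = 0) (c : ℝ) (x : E3) :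
    box c v 0 x = pt (pt v) 0 x := by
  unfold box
  simp [fun j => pd_zero_of_zero (f := pd j v) (t := 0) (fun x => pd_zero_of_zero hv0 j x) j x]

lemma abs_Dp_le (c : ℝ) (hc : 0 < c) (v : Fn) (t : ℝ) (x : E3) :
    |Dp c v t x| ≤ |pt v t x| + c * ∑ j, |pd j v t x| := by
  unfold Dp pr
  refine (abs_add_le _ _).trans ?_
  rw [abs_mul, abs_of_pos hc]
  gcongr
  refine (Finset.abs_sum_le_sum_abs _ _).trans (Finset.sum_le_sum fun j _ => ?_)
  rw [abs_mul, abs_div, abs_norm]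
  have h1 : |x j| / ‖x‖ ≤ 1 := div_le_one_of_le₀ (PiLp.norm_apply_le x j) (norm_nonneg x)
  exact mul_le_of_le_one_left (abs_nonneg _) h1

/-- The bound for `D₊u` obtained by estimating each first derivative separately. -/
lemma abs_Dp_le_near {c t κ B K M : ℝ} {S : ℝ → ℝ → ℝ} (hS : RayWeight c K S)
    (hSM : ∀ s, S 0 s ≤ M) (hc : 0 < c) (ht : 0 ≤ t) (hκ1 : 1 ≤ κ) (hB0 : 0 ≤ B) (hK : 0 ≤ K)
    {x : E3} (hx : x ≠ 0) {u : Fn} (hu : Smooth u) (hu0 : ∀ x, u 0 x = 0)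
    (hu1 : ∀ x, pt u 0 x = 0) (hB : ConeBound c κ B S t x (box c u))
    (hBt : ConeBound c κ B S t x (pt (box c u)))
    (hBx : ∀ j, ConeBound c κ B S t x (pd j (box c u))) :
    |Dp c u t x| ≤ c⁻¹ * (M + K + 3 * c * K) * B *
      ((1 + |c * t - ‖x‖|) ^ (1 - κ) * (1 + (c * t + ‖x‖))⁻¹ *
        (1 + Real.log (1 + (c * t + ‖x‖)))) := by
  have hM : 0 ≤ M := (hS.nonneg 0 0).trans (hSM 0)
  have h1 := abs_wave_le_log hS hc ht hκ1 hB0 hK (mul_nonneg hB0 hM) hx hu.pt hu1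
    (by rw [box_pt hu]; exact hBt) (by
      intro y hy
      rw [← box_eq_pt_pt_of_zero hu0 c]
      have := hB 0 y le_rfl ht (by simpa using hy)
      simp only [mul_zero, zero_add, abs_norm] at this
      refine this.trans ?_
      rw [mul_assoc, mul_comm M]
      gcongr
      exact hSM _)
  have h2 : ∀ j, _ := fun j => abs_wave_le_log hS hc ht hκ1 hB0 hK le_rfl hx (hu.pd j)
    (fun x => pd_zero_of_zero hu0 j x) (by rw [box_pd hu]; exact hBx j) (by
      intro y hy
      rw [pt_pd_comm hu, pd_zero_of_zero hu1]; simp)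
  refine (abs_Dp_le c hc u t x).trans ?_
  calc _ ≤ _ := add_le_add h1 (mul_le_mul_of_nonneg_left (Finset.sum_le_sum fun j _ => h2 j) hc.le)
    _ = _ := by simp; field_simp

lemma ray_weight_integral_le {c t r : ℝ} (hc : 0 < c) (ht : 0 ≤ t) (hr : 1 ≤ r) :
    ∫ s in 0..t, ((r + c * t - c * s)⁻¹ + 2 * (1 + |2 * c * s - (r + c * t)|)⁻¹) ≤
      5 * c⁻¹ * Real.log (1 + (c * t + r)) := by
  have hct := mul_nonneg hc.le ht
  have hpos : ∀ s ∈ Set.Icc 0 t, 0 < r + c * t - c * s := by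
    intro s hs
    have := mul_le_mul_of_nonneg_left hs.2 hc.le
    linarith
  have h := intervalIntegral.integral_le_sub_of_hasDeriv_right_of_le ht
    (g := fun s => c⁻¹ * (Real.arsinh (2 * c * s - (r + c * t)) - Real.log (r + c * t - c * s)))
    (φ := fun s => (r + c * t - c * s)⁻¹ + 2 * (1 + |2 * c * s - (r + c * t)|)⁻¹)
    (g' := fun s => (r + c * t - c * s)⁻¹ + 2 * (√(1 + (2 * c * s - (r + c * t)) ^ 2))⁻¹)
    (by
      refine continuousOn_const.mul (ContinuousOn.sub (Continuous.continuousOn ?_)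
        (ContinuousOn.log (by fun_prop) fun s hs => (hpos s hs).ne'))
      exact Real.continuous_arsinh.comp (by fun_prop))
    (by
      intro s hs
      have h1 : HasDerivAt (fun s => 2 * c * s - (r + c * t)) (2 * c) s := by
        simpa using ((hasDerivAt_id s).const_mul (2 * c)).sub_const (r + c * t)
      have h2 : HasDerivAt (fun s => r + c * t - c * s) (-c) s := by
        simpa using ((hasDerivAt_id s).const_mul c).const_sub (r + c * t)
      have h3 := hpos s (Set.Ioo_subset_Icc_self hs)
      have := ((h1.arsinh).sub (h2.log h3.ne')).const_mul c⁻¹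
      refine (this.congr_deriv ?_).hasDerivWithinAt
      rw [smul_eq_mul]
      field_simp
      ring)
    (by
      have : Continuous fun s => 2 * (1 + |2 * c * s - (r + c * t)|)⁻¹ :=
        continuous_const.mul (Continuous.inv₀ (by fun_prop) fun s => by positivity)
      exact ((ContinuousOn.inv₀ (by fun_prop) fun s hs => (hpos s hs).ne').add
        this.continuousOn).integrableOn_compact isCompact_Icc)
    (by
      intro s _
      gcongr
      rw [Real.sqrt_le_left (by positivity)]
      nlinarith [abs_nonneg (2 * c * s - (r + c * t)), sq_abs (2 * c * s - (r + c * t))])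
  refine h.trans ?_
  have hR : 0 ≤ c * t + r := by linarith
  have hL : Real.arsinh (c * t + r) ≤ 2 * Real.log (1 + (c * t + r)) := by
    rw [Real.arsinh, ← Real.log_rpow (by positivity)]
    refine Real.log_le_log (by positivity) ?_
    have : √(1 + (c * t + r) ^ 2) ≤ 1 + (c * t + r) := by
      rw [Real.sqrt_le_left (by positivity)]; nlinarith
    norm_num
    nlinarith
  have h1 : Real.arsinh (2 * c * t - (r + c * t)) ≤ Real.arsinh (c * t + r) :=
    Real.arsinh_le_arsinh.2 (by linarith)
  have h2 : Real.arsinh (2 * c * 0 - (r + c * t)) = -Real.arsinh (c * t + r) := by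
    rw [← Real.arsinh_neg]; congr 1; ring
  have h3 : 0 ≤ Real.log (r + c * t - c * t) := Real.log_nonneg (by linarith)
  have h4 : Real.log (r + c * t - c * 0) ≤ Real.log (1 + (c * t + r)) :=
    Real.log_le_log (by linarith) (by linarith)
  have h5 : (Real.arsinh (2 * c * t - (r + c * t)) - Real.log (r + c * t - c * t)) -
      (Real.arsinh (2 * c * 0 - (r + c * t)) - Real.log (r + c * t - c * 0)) ≤
        5 * Real.log (1 + (c * t + r)) := by linarith
  rw [← mul_sub]
  exact (mul_le_mul_of_nonneg_left h5 (inv_nonneg.2 hc.le)).trans (le_of_eq (by ring))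

/-- The bound for `D₊u` obtained by integration along the incoming ray. -/
lemma abs_Dp_le_far {c t κ B K : ℝ} {S : ℝ → ℝ → ℝ} (hS : RayWeight c K S) (hc : 0 < c)
    (ht : 0 ≤ t) (hκ1 : 1 ≤ κ) (hκ2 : κ ≤ 2) (hB0 : 0 ≤ B) (hK : 0 ≤ K) {x : E3}
    (hx : 1 ≤ ‖x‖) {u : Fn} (hu : Smooth u) (hu0 : ∀ x, u 0 x = 0) (hu1 : ∀ x, pt u 0 x = 0)
    (hB : ConeBound c κ B S t x (box c u))
    (hBΩ : ∀ j k, j < k → ConeBound c κ B S t x (rotA j k (rotA j k (box c u)))) :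
    ‖x‖ * |Dp c u t x| ≤ 16 * K * B *
      ((1 + |c * t - ‖x‖|) ^ (1 - κ) * (1 + (c * t + ‖x‖))⁻¹ *
        (1 + Real.log (1 + (c * t + ‖x‖)))) := by
  have hr : 0 < ‖x‖ := by linarith
  have hx0 : x ≠ 0 := norm_pos_iff.1 hr
  have hct := mul_nonneg hc.le ht
  have hR : 0 ≤ c * t + ‖x‖ := by positivity
  have hqR : |c * t - ‖x‖| ≤ c * t + ‖x‖ := abs_le.2 ⟨by linarith, by linarith⟩
  set L := Real.log (1 + (c * t + ‖x‖)) with hL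
  have hL0 : 0 ≤ L := Real.log_nonneg (by linarith)
  set P := (1 + |c * t - ‖x‖|) ^ (1 - κ) * (1 + (c * t + ‖x‖))⁻¹ with hP
  have hP0 : 0 ≤ P := by positivity
  have hw : ‖‖x‖⁻¹ • x‖ = 1 := by rw [norm_smul, norm_inv, norm_norm, inv_mul_cancel₀ hr.ne']
  have h1 := abs_wave_le_log hS hc ht hκ1 hB0 hK le_rfl hx0 hu hu0 hB (by simp [hu1])
  have hW : (1 + (c * t + ‖x‖)) ^ (-κ) ≤ P := by
    have : (1 + (c * t + ‖x‖)) ^ (-κ) = (1 + (c * t + ‖x‖)) ^ (1 - κ) * (1 + (c * t + ‖x‖))⁻¹ := by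
      rw [← Real.rpow_neg_one, ← Real.rpow_add (by positivity)]; congr 1; ring
    rw [this, hP]
    gcongr ?_ * _
    exact Real.rpow_le_rpow_of_nonpos (by positivity) (by linarith) (by linarith)
  have h2 := ray_identity hu hu0 hu1 hc ht hx0
  set Q := (1 + (c * t + ‖x‖)) ^ (-κ) with hQ
  have hQ0 : 0 ≤ Q := by positivity
  have hpos : ∀ s ∈ Set.Icc 0 t, 0 < ‖x‖ + c * t - c * s := by
    intro s hs
    have := mul_le_mul_of_nonneg_left hs.2 hc.le
    linarith
  have main : ∀ s ∈ Set.Ioc 0 t, ‖(‖x‖ + c * t - c * s) * box c u s ((‖x‖ + c * t - c * s) • ‖x‖⁻¹ • x) +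
      c ^ 2 * ((‖x‖ + c * t - c * s)⁻¹ * sphLap u s ((‖x‖ + c * t - c * s) • ‖x‖⁻¹ • x))‖ ≤
      B * Q * S s (c * t + ‖x‖ - c * s) + 3 * c * B * K * Q *
        ((‖x‖ + c * t - c * s)⁻¹ + 2 * (1 + |2 * c * s - (‖x‖ + c * t)|)⁻¹) := by
    intro s hs
    have hl := hpos s (Set.Ioc_subset_Icc_self hs)
    set l := ‖x‖ + c * t - c * s with hl_def
    set y := l • ‖x‖⁻¹ • x with hy
    have hyn : ‖y‖ = l := by rw [hy, norm_smul, hw, mul_one, Real.norm_eq_abs, abs_of_pos hl]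
    have hy0 : y ≠ 0 := norm_pos_iff.1 (hyn ▸ hl)
    have hyx : ‖y - x‖ ≤ c * (t - s) := by
      have : y - x = (c * (t - s)) • ‖x‖⁻¹ • x := by
        have hx' : x = ‖x‖ • ‖x‖⁻¹ • x := by
          rw [smul_smul, mul_inv_cancel₀ hr.ne', one_smul]
        calc y - x = l • ‖x‖⁻¹ • x - ‖x‖ • ‖x‖⁻¹ • x := by rw [← hx']
          _ = _ := by rw [← sub_smul, hl_def]; congr 1; ring
      rw [this, norm_smul, hw, mul_one, Real.norm_eq_abs,
        abs_of_nonneg (mul_nonneg hc.le (sub_nonneg.2 hs.2))]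
    have a1 := hB s y hs.1.le hs.2 hyx
    have e0 : c * s + l = c * t + ‖x‖ := by rw [hl_def]; ring
    rw [hyn, e0, abs_of_nonneg hR, ← hQ] at a1
    have a2 : ∀ j k, j < k → |rotA j k (rotA j k u) s y| ≤
        c⁻¹ * B * K * ((1 + (c * t + ‖x‖)) ^ (1 - κ) / (1 + |c * s - l|)) := by
      intro j k hjk
      have := abs_wave_le_of_two hS hc hs.1.le hκ2 hB0 hK hy0 ((hu.rotA j k).rotA j k)
        (rotA_zero_of_zero (rotA_zero_of_zero hu0 j k) j k) (by
          intro z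
          rw [pt_rotA (hu.rotA j k), pt_rotA hu]
          exact rotA_zero_of_zero (rotA_zero_of_zero hu1 j k) j k z)
        (by rw [box_rotA (hu.rotA j k), box_rotA hu]; exact (hBΩ j k hjk).mono hs.2 hyx)
      rwa [hyn, e0] at this
    have a3 : |sphLap u s y| ≤
        3 * (c⁻¹ * B * K * ((1 + (c * t + ‖x‖)) ^ (1 - κ) / (1 + |c * s - l|))) := by
      unfold sphLap
      refine (abs_add_three _ _ _).trans ?_
      linarith [a2 0 1 (by decide), a2 0 2 (by decide), a2 1 2 (by decide)]
    have e1 : (1 + (c * t + ‖x‖)) ^ (1 - κ) = Q * (1 + (c * t + ‖x‖)) := by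
      rw [hQ, ← Real.rpow_add_one (by positivity)]; congr 1; ring
    have e2 : 2 * c * s - (‖x‖ + c * t) = c * s - l := by rw [hl_def]; ring
    have e3 : c * t + ‖x‖ - c * s = l := by rw [hl_def]; ring
    rw [Real.norm_eq_abs, e2, e3]
    refine (abs_add_le _ _).trans (add_le_add ?_ ?_)
    · rw [abs_mul, abs_of_pos hl]
      exact a1.trans (le_of_eq (by ring))
    · rw [abs_mul, abs_mul, abs_of_pos (inv_pos.2 hl), abs_of_pos (by positivity : 0 < c ^ 2)]
      have a4 : 1 + (c * t + ‖x‖) ≤ 1 + |c * s - l| + 2 * l := by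
        have := neg_abs_le (c * s - l)
        have : c * s - l = c * t + ‖x‖ - 2 * l := by rw [hl_def]; ring
        have := le_abs_self (c * s - l)
        linarith
      calc c ^ 2 * (l⁻¹ * |sphLap u s y|) ≤ c ^ 2 * (l⁻¹ *
            (3 * (c⁻¹ * B * K * (Q * (1 + |c * s - l| + 2 * l) / (1 + |c * s - l|))))) := by
            rw [e1] at a3
            have : Q * (1 + (c * t + ‖x‖)) / (1 + |c * s - l|) ≤
              Q * (1 + |c * s - l| + 2 * l) / (1 + |c * s - l|) := by gcongr
            gcongr
            refine a3.trans ?_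
            gcongr
        _ = _ := by
            have : 0 < 1 + |c * s - l| := by positivity
            field_simp
  have cS : Continuous fun s => S s (c * t + ‖x‖ - c * s) :=
    hS.continuous.comp (by fun_prop : Continuous fun s => (s, c * t + ‖x‖ - c * s))
  have i1 : IntervalIntegrable (fun s => B * Q * S s (c * t + ‖x‖ - c * s)) volume 0 t :=
    (continuous_const.mul cS).intervalIntegrable _ _
  have i2 : IntervalIntegrable (fun s => 3 * c * B * K * Q *
        ((‖x‖ + c * t - c * s)⁻¹ + 2 * (1 + |2 * c * s - (‖x‖ + c * t)|)⁻¹)) volume 0 t := by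
    have c1 : Continuous fun s => 2 * (1 + |2 * c * s - (‖x‖ + c * t)|)⁻¹ :=
      continuous_const.mul (Continuous.inv₀ (by fun_prop) fun s => by positivity)
    have c2 : ContinuousOn (fun s => (‖x‖ + c * t - c * s)⁻¹) (Set.uIcc 0 t) := by
      rw [Set.uIcc_of_le ht]
      exact ContinuousOn.inv₀ (by fun_prop) fun s hs => (hpos s hs).ne'
    exact (continuousOn_const.mul (c2.add c1.continuousOn)).intervalIntegrable
  have h3 := intervalIntegral.norm_integral_le_of_norm_le (μ := volume) ht
    (Filter.Eventually.of_forall main) (i1.add i2)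
  rw [← h2, intervalIntegral.integral_add i1 i2, intervalIntegral.integral_const_mul,
    intervalIntegral.integral_const_mul, Real.norm_eq_abs] at h3
  have h4 : B * Q * (∫ s in 0..t, S s (c * t + ‖x‖ - c * s)) + 3 * c * B * K * Q *
      (∫ s in 0..t, ((‖x‖ + c * t - c * s)⁻¹ + 2 * (1 + |2 * c * s - (‖x‖ + c * t)|)⁻¹)) ≤
      B * P * K + 3 * c * B * K * P * (5 * c⁻¹ * L) := by
    have i3 := hS.integral_le (c * t + ‖x‖) t ht
    have i4 := ray_weight_integral_le hc ht hx
    have i5 : 0 ≤ 5 * c⁻¹ * L := by positivity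
    refine add_le_add ?_ ?_
    · exact (mul_le_mul_of_nonneg_left i3 (by positivity)).trans (by gcongr)
    · exact (mul_le_mul_of_nonneg_left i4 (by positivity)).trans (by gcongr)
  have h5 : ‖x‖ * |Dp c u t x| ≤ |‖x‖ * Dp c u t x + c * u t x| + c * |u t x| := by
    rw [← abs_of_pos hr, ← abs_mul, abs_of_pos hr, ← abs_of_pos hc, ← abs_mul, abs_of_pos hc]
    have := abs_sub (‖x‖ * Dp c u t x + c * u t x) (c * u t x)
    rwa [add_sub_cancel_right] at this
  calc _ ≤ _ := h5
    _ ≤ (B * P * K + 3 * c * B * K * P * (5 * c⁻¹ * L)) + c * (c⁻¹ * (0 + B * K) * (P * (1 + L))) := by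
      gcongr
      exact h3.trans h4
    _ = B * K * P * (2 + 16 * L) := by field_simp; ring
    _ ≤ B * K * P * (16 * (1 + L)) := by gcongr; linarith
    _ = _ := by ring

/-- The pointwise decay estimate for `D₊u` under weighted bounds for the source term. -/
lemma weighted_abs_Dp_le {c t κ B K M : ℝ} {S : ℝ → ℝ → ℝ} (hS : RayWeight c K S)
    (hSM : ∀ s, S 0 s ≤ M) (hc : 0 < c) (ht : 0 ≤ t) (hκ1 : 1 ≤ κ) (hκ2 : κ ≤ 2) (hB0 : 0 ≤ B)
    (hK : 0 ≤ K) {x : E3} (hx : x ≠ 0) {u : Fn} (hu : Smooth u) (hu0 : ∀ x, u 0 x = 0)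
    (hu1 : ∀ x, pt u 0 x = 0) (hB : ConeBound c κ B S t x (box c u))
    (hBt : ConeBound c κ B S t x (pt (box c u)))
    (hBx : ∀ j, ConeBound c κ B S t x (pd j (box c u)))
    (hBΩ : ∀ j k, j < k → ConeBound c κ B S t x (rotA j k (rotA j k (box c u)))) :
    (1 + ‖x‖) * (1 + (c * t + ‖x‖)) * (1 + |c * t - ‖x‖|) ^ (κ - 1) * |Dp c u t x| ≤
      (2 * c⁻¹ * (M + K + 3 * c * K) + 32 * K) * B * (1 + Real.log (1 + (c * t + ‖x‖))) := by
  have hM : 0 ≤ M := (hS.nonneg 0 0).trans (hSM 0)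
  have hct := mul_nonneg hc.le ht
  have hL0 : 0 ≤ Real.log (1 + (c * t + ‖x‖)) :=
    Real.log_nonneg (by linarith [norm_nonneg x])
  have key : (1 + ‖x‖) * |Dp c u t x| ≤ (2 * c⁻¹ * (M + K + 3 * c * K) + 32 * K) * B *
      ((1 + |c * t - ‖x‖|) ^ (1 - κ) * (1 + (c * t + ‖x‖))⁻¹ *
        (1 + Real.log (1 + (c * t + ‖x‖)))) := by
    set Z := (1 + |c * t - ‖x‖|) ^ (1 - κ) * (1 + (c * t + ‖x‖))⁻¹ *
        (1 + Real.log (1 + (c * t + ‖x‖))) with hZ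
    have hZ0 : 0 ≤ Z := by positivity
    have hD := abs_nonneg (Dp c u t x)
    rcases le_total ‖x‖ 1 with h | h
    · have h1 := abs_Dp_le_near hS hSM hc ht hκ1 hB0 hK hx hu hu0 hu1 hB hBt hBx
      rw [← hZ] at h1
      have : 0 ≤ 32 * K * B * Z := by positivity
      nlinarith
    · have h1 := abs_Dp_le_far hS hc ht hκ1 hκ2 hB0 hK h hu hu0 hu1 hB hBΩ
      rw [← hZ] at h1
      have : 0 ≤ 2 * c⁻¹ * (M + K + 3 * c * K) * B * Z := by positivity
      nlinarith
  have e : (1 + |c * t - ‖x‖|) ^ (κ - 1) * (1 + |c * t - ‖x‖|) ^ (1 - κ) = 1 := by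
    rw [← Real.rpow_add (by positivity)]; simp
  calc _ = (1 + (c * t + ‖x‖)) * (1 + |c * t - ‖x‖|) ^ (κ - 1) * ((1 + ‖x‖) * |Dp c u t x|) := by ring
    _ ≤ (1 + (c * t + ‖x‖)) * (1 + |c * t - ‖x‖|) ^ (κ - 1) * _ :=
      mul_le_mul_of_nonneg_left key (by positivity)
    _ = (2 * c⁻¹ * (M + K + 3 * c * K) + 32 * K) * B * (1 + Real.log (1 + (c * t + ‖x‖))) *
        ((1 + |c * t - ‖x‖|) ^ (κ - 1) * (1 + |c * t - ‖x‖|) ^ (1 - κ)) *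
        ((1 + (c * t + ‖x‖)) * (1 + (c * t + ‖x‖))⁻¹) := by ring
    _ = _ := by rw [e, mul_inv_cancel₀ (by positivity)]; ring

/-- The weight `Σ_j (1 + |c_j τ - s|)^{-(1+μ)}`, comparable to `w(τ,s)^{-(1+μ)}`. -/
def sumWeight {N : ℕ} (μ : ℝ) (cs : Fin N → ℝ) (τ s : ℝ) : ℝ :=
  ∑ j, (1 + |cs0 cs j * τ - s|) ^ (-(1 + μ))

lemma cs0_nonneg {N : ℕ} {cs : Fin N → ℝ} (hcs : ∀ j, 0 < cs j) (j : Fin (N + 1)) :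
    0 ≤ cs0 cs j := by
  refine Fin.cases ?_ (fun i => ?_) j
  · simp [cs0]
  · simpa [cs0] using (hcs i).le

lemma integrable_one_add_abs_rpow {μ : ℝ} (hμ : 0 < μ) :
    Integrable fun s : ℝ => (1 + |s|) ^ (-(1 + μ)) := by
  have := integrable_one_add_norm (E := ℝ) (μ := volume) (r := 1 + μ) (by simpa using hμ)
  simpa using this

lemma rayWeight_sumWeight {N : ℕ} {cs : Fin N → ℝ} (hcs : ∀ j, 0 < cs j) {c μ : ℝ} (hc : 0 < c)
    (hμ : 0 < μ) :
    RayWeight c (∑ j, (cs0 cs j + c)⁻¹ * ∫ s : ℝ, (1 + |s|) ^ (-(1 + μ))) (sumWeight μ cs) where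
  continuous := by
    unfold sumWeight
    refine continuous_finsetSum _ fun j _ => ?_
    exact (continuous_one_add_abs_rpow _).comp
      (by fun_prop : Continuous fun p : ℝ × ℝ => cs0 cs j * p.1 - p.2)
  nonneg τ s := Finset.sum_nonneg fun j _ => by positivity
  integral_le R T hT := by
    unfold sumWeight
    have hi : ∀ j ∈ Finset.univ, IntervalIntegrable
        (fun τ => (1 + |cs0 cs j * τ - (R - c * τ)|) ^ (-(1 + μ))) volume 0 T := fun j _ =>
      ((continuous_one_add_abs_rpow _).comp
        (by fun_prop : Continuous fun τ : ℝ => cs0 cs j * τ - (R - c * τ))).intervalIntegrable _ _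
    rw [intervalIntegral.integral_finsetSum hi]
    refine Finset.sum_le_sum fun j _ => ?_
    have ha : 0 < cs0 cs j + c := add_pos_of_nonneg_of_pos (cs0_nonneg hcs j) hc
    have e : ∀ τ, cs0 cs j * τ - (R - c * τ) = (cs0 cs j + c) * τ - R := fun τ => by ring
    simp only [e]
    rw [intervalIntegral.integral_comp_mul_sub (fun s => (1 + |s|) ^ (-(1 + μ))) ha.ne',
      smul_eq_mul]
    gcongr
    rw [intervalIntegral.integral_of_le (by linarith [mul_nonneg ha.le hT])]
    exact setIntegral_le_integral (integrable_one_add_abs_rpow hμ)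
      (Filter.Eventually.of_forall fun s => by positivity)

lemma sumWeight_zero_le {N : ℕ} (cs : Fin N → ℝ) {μ : ℝ} (hμ : 0 < μ) (s : ℝ) :
    sumWeight μ cs 0 s ≤ N + 1 := by
  unfold sumWeight
  refine (Finset.sum_le_card_nsmul _ _ 1 fun j _ => ?_).trans (by simp)
  exact Real.rpow_le_one_of_one_le_of_nonpos (by linarith [abs_nonneg (cs0 cs j * 0 - s)])
    (by linarith)

lemma jb_pos (a : ℝ) : 0 < jb a := Real.sqrt_pos.2 (by positivity)

lemma jb_le_one_add_abs (a : ℝ) : jb a ≤ 1 + |a| := by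
  unfold jb
  rw [Real.sqrt_le_left (by positivity)]
  nlinarith [abs_nonneg a, sq_abs a]

lemma one_add_abs_le_two_mul_jb (a : ℝ) : 1 + |a| ≤ 2 * jb a := by
  have h1 : 1 ≤ jb a := Real.one_le_sqrt.2 (by nlinarith [sq_nonneg a])
  have h2 : |a| ≤ jb a := Real.abs_le_sqrt (by linarith)
  linarith

lemma continuous_jb : Continuous jb := by
  unfold jb
  fun_prop

lemma wgt_pos {N : ℕ} (cs : Fin N → ℝ) (τ s : ℝ) : 0 < wgt cs τ s := by
  unfold wgt
  rw [Finset.lt_inf'_iff]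
  exact fun j _ => jb_pos _

lemma continuous_wgt {N : ℕ} (cs : Fin N → ℝ) :
    Continuous fun p : ℝ × ℝ => wgt cs p.1 p.2 := by
  unfold wgt
  refine Continuous.finset_inf'_apply _ fun j _ => ?_
  exact continuous_jb.comp (by fun_prop)

lemma wgt_rpow_neg_le {N : ℕ} (cs : Fin N → ℝ) {μ : ℝ} (hμ : 0 < μ) (τ s : ℝ) :
    wgt cs τ s ^ (-(1 + μ)) ≤ 2 ^ (1 + μ) * sumWeight μ cs τ s := by
  obtain ⟨j, -, hj⟩ := Finset.exists_mem_eq_inf' (Finset.univ_nonempty (α := Fin (N + 1)))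
    fun j => jb (cs0 cs j * τ - s)
  have e : wgt cs τ s = jb (cs0 cs j * τ - s) := hj
  have h1 : (2 * jb (cs0 cs j * τ - s)) ^ (-(1 + μ)) ≤ (1 + |cs0 cs j * τ - s|) ^ (-(1 + μ)) :=
    Real.rpow_le_rpow_of_nonpos (by positivity) (one_add_abs_le_two_mul_jb _) (by linarith)
  have h2 : (1 + |cs0 cs j * τ - s|) ^ (-(1 + μ)) ≤ sumWeight μ cs τ s :=
    Finset.single_le_sum (f := fun j => (1 + |cs0 cs j * τ - s|) ^ (-(1 + μ)))
      (fun i _ => by positivity) (Finset.mem_univ j)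
  rw [Real.mul_rpow (by norm_num) (jb_pos _).le, Real.rpow_neg (by norm_num)] at h1
  rw [e, ← inv_mul_le_iff₀ (by positivity)]
  exact h1.trans h2

/-- Comparability of `1 + c τ + s` and `⟨τ + s⟩`. -/
lemma one_add_mul_add_le {c τ s : ℝ} (hc : 0 < c) (hτ : 0 ≤ τ) (hs : 0 ≤ s) :
    1 + (c * τ + s) ≤ 2 * (1 + c) * jb (τ + s) := by
  have := one_add_abs_le_two_mul_jb (τ + s)
  rw [abs_of_nonneg (by positivity)] at this
  nlinarith [mul_nonneg hc.le hτ, mul_nonneg hc.le hs]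

lemma jb_rpow_neg_le {c κ τ s : ℝ} (hc : 0 < c) (hκ1 : 1 ≤ κ) (hτ : 0 ≤ τ) (hs : 0 ≤ s) :
    jb (τ + s) ^ (-κ) ≤ (2 * (1 + c)) ^ κ * (1 + |c * τ + s|) ^ (-κ) := by
  have hct := mul_nonneg hc.le hτ
  rw [abs_of_nonneg (by positivity)]
  have h1 : (2 * (1 + c) * jb (τ + s)) ^ (-κ) ≤ (1 + (c * τ + s)) ^ (-κ) :=
    Real.rpow_le_rpow_of_nonpos (by positivity) (one_add_mul_add_le hc hτ hs) (by linarith)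
  rw [Real.mul_rpow (by positivity) (jb_pos _).le, Real.rpow_neg (by positivity)] at h1
  rwa [← inv_mul_le_iff₀ (by positivity)]

lemma one_add_log_le {c t s : ℝ} (hc : 0 < c) (ht : 0 ≤ t) (hs : 0 ≤ s) :
    1 + Real.log (1 + (c * t + s)) ≤ ((1 + Real.log (1 + c)) / Real.log 2 + 1) *
      Real.log (2 + t + s) := by
  have hct := mul_nonneg hc.le ht
  have hcs := mul_nonneg hc.le hs
  have h2 : 0 < Real.log 2 := Real.log_pos (by norm_num)
  have h3 : 0 ≤ Real.log (1 + c) := Real.log_nonneg (by linarith)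
  have h1 : Real.log (1 + (c * t + s)) ≤ Real.log (1 + c) + Real.log (2 + t + s) := by
    rw [← Real.log_mul (by positivity) (by positivity)]
    exact Real.log_le_log (by positivity) (by nlinarith)
  have h4 : Real.log 2 ≤ Real.log (2 + t + s) := Real.log_le_log (by norm_num) (by linarith)
  have h5 : 1 + Real.log (1 + c) ≤ (1 + Real.log (1 + c)) / Real.log 2 * Real.log (2 + t + s) := by
    calc _ = (1 + Real.log (1 + c)) / Real.log 2 * Real.log 2 := by field_simp
      _ ≤ _ := by gcongr
  linarith

lemma Smooth.zop {f : Fn} (hf : Smooth f) (i : Fin 7) : Smooth (Zop i f) := by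
  fin_cases i
  exacts [hf.pt, hf.pd 0, hf.pd 1, hf.pd 2, hf.rotA 0 1, hf.rotA 0 2, hf.rotA 1 2]

lemma Smooth.iterate_zop {f : Fn} (hf : Smooth f) (i : Fin 7) (n : ℕ) :
    Smooth ((Zop i)^[n] f) := by
  induction n with
  | zero => exact hf
  | succ n ih => rw [Function.iterate_succ_apply']; exact ih.zop i

lemma Smooth.zpow {f : Fn} (hf : Smooth f) (α : Fin 7 → ℕ) : Smooth (Zpow α f) :=
  ((((((hf.iterate_zop 6 _).iterate_zop 5 _).iterate_zop 4 _).iterate_zop 3 _).iterate_zop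
    2 _).iterate_zop 1 _).iterate_zop 0 _

lemma Smooth.continuous_vnorm {f : Fn} (hf : Smooth f) (s : ℕ) :
    Continuous fun p : ℝ × E3 => vnorm s f p.1 p.2 := by
  unfold vnorm
  exact continuous_finsetSum _ fun α _ => (hf.zpow α).continuous.abs

lemma vnorm_nonneg (s : ℕ) (f : Fn) (t : ℝ) (x : E3) : 0 ≤ vnorm s f t x :=
  Finset.sum_nonneg fun _ _ => abs_nonneg _

lemma abs_iterate_Zop_le_vnorm (i : Fin 7) {n s : ℕ} (hn : n ≤ s) (f : Fn) (t : ℝ) (x : E3) :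
    |(Zop i)^[n] f t x| ≤ vnorm s f t x := by
  have e : Zpow (Pi.single i n) f = (Zop i)^[n] f := by
    fin_cases i <;> simp [Zpow]
  rw [← e]
  refine Finset.single_le_sum (f := fun α => |Zpow α f t x|) (fun _ _ => abs_nonneg _) ?_
  simp only [multiIdx, Finset.mem_filter, Fintype.mem_piFinset, Finset.mem_range,
    Finset.sum_pi_single', Finset.mem_univ, if_true]
  refine ⟨fun j => ?_, by simpa using hn⟩
  rw [Pi.single_apply]
  split_ifs <;> omega

/-- The set whose supremum is `Afun` is bounded above, so `Afun` dominates each of its elements. -/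
lemma le_Afun {G : Fn} (hG : Smooth G) {κ μ : ℝ} (s : ℕ) (hκ : 0 ≤ κ) (hμ : 0 ≤ μ) {c : ℝ}
    (hc : 0 ≤ c) {N : ℕ} (cs : Fin N → ℝ) {t τ : ℝ} {x y : E3} (hτ : 0 ≤ τ) (hτt : τ ≤ t)
    (hy : ‖y - x‖ ≤ c * (t - τ)) :
    ‖y‖ * jb (τ + ‖y‖) ^ κ * wgt cs τ ‖y‖ ^ (1 + μ) * vnorm s G τ y ≤ Afun κ μ s G c cs t x := by
  have hF : Continuous fun p : ℝ × E3 =>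
      ‖p.2‖ * jb (p.1 + ‖p.2‖) ^ κ * wgt cs p.1 ‖p.2‖ ^ (1 + μ) * vnorm s G p.1 p.2 := by
    have h1 : Continuous fun p : ℝ × E3 => jb (p.1 + ‖p.2‖) := continuous_jb.comp (by fun_prop)
    have h2 : Continuous fun p : ℝ × E3 => wgt cs p.1 ‖p.2‖ := by
      have h := (continuous_wgt cs).comp (continuous_fst.prodMk (continuous_norm.comp
        continuous_snd) : Continuous fun p : ℝ × E3 => (p.1, ‖p.2‖))
      exact h
    have h3 : Continuous fun p : ℝ × E3 => jb (p.1 + ‖p.2‖) ^ κ :=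
      h1.rpow_const fun _ => Or.inr hκ
    have h4 : Continuous fun p : ℝ × E3 => wgt cs p.1 ‖p.2‖ ^ (1 + μ) :=
      h2.rpow_const fun _ => Or.inr (by linarith)
    have h5 : Continuous fun p : ℝ × E3 => ‖p.2‖ := by fun_prop
    exact ((h5.mul h3).mul h4).mul (hG.continuous_vnorm s)
  have hK := ((isCompact_Icc (a := (0 : ℝ)) (b := t)).prod
    (isCompact_closedBall x (c * t))).bddAbove_image hF.continuousOn
  refine le_csSup (hK.mono ?_) ⟨τ, y, hτ, hτt, hy, rfl⟩
  rintro a ⟨σ, z, h1, h2, h3, rfl⟩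
  refine ⟨(σ, z), ⟨⟨h1, h2⟩, ?_⟩, rfl⟩
  rw [Metric.mem_closedBall, dist_eq_norm]
  nlinarith [mul_nonneg hc h1]

lemma Afun_nonneg {G : Fn} (κ μ : ℝ) (s : ℕ) (c : ℝ) {N : ℕ} (cs : Fin N → ℝ) (t : ℝ) (x : E3) :
    0 ≤ Afun κ μ s G c cs t x := by
  refine Real.sSup_nonneg ?_
  rintro a ⟨σ, z, -, -, -, rfl⟩
  have := (jb_pos (σ + ‖z‖)).le
  have := (wgt_pos cs σ ‖z‖).le
  have := vnorm_nonneg s G σ z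
  positivity

lemma coneBound_of_Afun {G h : Fn} (hG : Smooth G) {κ μ c : ℝ} (hκ1 : 1 ≤ κ) (hμ : 0 < μ)
    (hc : 0 < c) {N : ℕ} (cs : Fin N → ℝ) (t : ℝ) (x : E3) (i : Fin 7) {n s : ℕ} (hn : n ≤ s)
    (hh : ∀ τ y, 0 ≤ τ → h τ y = (Zop i)^[n] G τ y) :
    ConeBound c κ (Afun κ μ s G c cs t x * ((2 * (1 + c)) ^ κ * 2 ^ (1 + μ))) (sumWeight μ cs)
      t x h := by
  intro τ y hτ hτt hy
  have hA := le_Afun hG s (by linarith : 0 ≤ κ) hμ.le hc.le cs hτ hτt hy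
  have hA0 := Afun_nonneg (G := G) κ μ s c cs t x
  have hj := jb_pos (τ + ‖y‖)
  have hw := wgt_pos cs τ ‖y‖
  have h1 := jb_rpow_neg_le hc hκ1 hτ (norm_nonneg y)
  have h2 := wgt_rpow_neg_le cs hμ τ ‖y‖
  have h3 := abs_iterate_Zop_le_vnorm i hn G τ y
  rw [← hh τ y hτ] at h3
  have e1 : jb (τ + ‖y‖) ^ (-κ) * jb (τ + ‖y‖) ^ κ = 1 := by
    rw [← Real.rpow_add hj]; simp
  have e2 : wgt cs τ ‖y‖ ^ (-(1 + μ)) * wgt cs τ ‖y‖ ^ (1 + μ) = 1 := by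
    rw [← Real.rpow_add hw]; simp
  calc ‖y‖ * |h τ y| ≤ ‖y‖ * vnorm s G τ y := by gcongr
    _ = (jb (τ + ‖y‖) ^ (-κ) * jb (τ + ‖y‖) ^ κ) *
        (wgt cs τ ‖y‖ ^ (-(1 + μ)) * wgt cs τ ‖y‖ ^ (1 + μ)) * (‖y‖ * vnorm s G τ y) := by
      rw [e1, e2]; ring
    _ = (‖y‖ * jb (τ + ‖y‖) ^ κ * wgt cs τ ‖y‖ ^ (1 + μ) * vnorm s G τ y) *
        (jb (τ + ‖y‖) ^ (-κ) * wgt cs τ ‖y‖ ^ (-(1 + μ))) := by ring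
    _ ≤ Afun κ μ s G c cs t x * (((2 * (1 + c)) ^ κ * (1 + |c * τ + ‖y‖|) ^ (-κ)) *
        (2 ^ (1 + μ) * sumWeight μ cs τ ‖y‖)) := by gcongr
    _ = _ := by ring

lemma Smooth.eq_of_pos {f g : Fn} (hf : Smooth f) (hg : Smooth g)
    (h : ∀ t x, 0 < t → f t x = g t x) (t : ℝ) (x : E3) (ht : 0 ≤ t) : f t x = g t x := by
  have h1 : Set.EqOn (fun t => f t x) (fun t => g t x) (Set.Ioi 0) := fun s hs => h s x hs
  have h2 := h1.closure (hf.differentiable_time x).continuous (hg.differentiable_time x).continuous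
  rw [closure_Ioi] at h2
  exact h2 ht

lemma pt_eq_of_pos {f g : Fn} (hf : Smooth f) (hg : Smooth g)
    (h : ∀ t x, 0 < t → f t x = g t x) (t : ℝ) (x : E3) (ht : 0 ≤ t) : pt f t x = pt g t x :=
  hf.pt.eq_of_pos hg.pt (fun s y hs => Filter.EventuallyEq.deriv_eq <| by
    filter_upwards [lt_mem_nhds hs] with σ hσ using h σ y hσ) t x ht

lemma pd_eq_of_nonneg {f g : Fn} (h : ∀ t x, 0 ≤ t → f t x = g t x) (j : Fin 3) (t : ℝ) (x : E3)
    (ht : 0 ≤ t) : pd j f t x = pd j g t x := by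
  have : f t = g t := funext fun x => h t x ht
  rw [pd, pd, this]

lemma rotA_eq_of_nonneg {f g : Fn} (h : ∀ t x, 0 ≤ t → f t x = g t x) (j k : Fin 3) (t : ℝ)
    (x : E3) (ht : 0 ≤ t) : rotA j k f t x = rotA j k g t x := by
  rw [rotA, rotA, pd_eq_of_nonneg h j t x ht, pd_eq_of_nonneg h k t x ht]

end Proof

theorem stmt0 (c : ℝ) (hc : 0 < c) {N : ℕ} (cs : Fin N → ℝ) (hcs : ∀ j, 0 < cs j)
    (κ μ : ℝ) (hκ1 : 1 ≤ κ) (hκ2 : κ ≤ 2) (hμ : 0 < μ) :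
    ∃ C > (0 : ℝ), ∀ G u : Fn, Smooth G → IsWaveSol c G u →
      ∀ (t : ℝ) (x : E3), 0 < t → x ≠ 0 →
        jb ‖x‖ * jb (t + ‖x‖) * jb (c * t - ‖x‖) ^ (κ - 1) *
            (Real.log (2 + t + ‖x‖))⁻¹ * |Dp c u t x| ≤
          C * Afun κ μ 2 G c cs t x := by
  have hS := rayWeight_sumWeight hcs hc hμ
  set K := ∑ j, (cs0 cs j + c)⁻¹ * ∫ s : ℝ, (1 + |s|) ^ (-(1 + μ))
  have hK : 0 ≤ K := Finset.sum_nonneg fun j _ => mul_nonneg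
    (inv_nonneg.2 (add_nonneg (cs0_nonneg hcs j) hc.le))
    (MeasureTheory.integral_nonneg fun s => by positivity)
  set C₀ := 2 * c⁻¹ * ((N + 1) + K + 3 * c * K) + 32 * K with hC₀
  have hC₀pos : 0 < C₀ := by positivity
  set C₁ := (2 * (1 + c)) ^ κ * 2 ^ (1 + μ) with hC₁
  have hC₁pos : 0 < C₁ := by positivity
  set C₂ := (1 + Real.log (1 + c)) / Real.log 2 + 1 with hC₂
  have hC₂pos : 0 < C₂ := by
    have : 0 ≤ Real.log (1 + c) := Real.log_nonneg (by linarith)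
    have : 0 < Real.log 2 := Real.log_pos (by norm_num)
    positivity
  refine ⟨(1 + c⁻¹) * (C₀ * C₁ * C₂), by positivity, fun G u hG hu t x ht hx => ?_⟩
  obtain ⟨hus, hueq, hu0, hu1⟩ := hu
  have hpos : ∀ t x, 0 < t → box c u t x = G t x := hueq
  have hbox : ∀ t x, 0 ≤ t → box c u t x = G t x := (hus.box c).eq_of_pos hG hpos
  have hrot : ∀ j k, ∀ t x, 0 ≤ t →
      rotA j k (rotA j k (box c u)) t x = rotA j k (rotA j k G) t x :=
    fun j k => rotA_eq_of_nonneg (rotA_eq_of_nonneg hbox j k) j k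
  have hA := Afun_nonneg (G := G) κ μ 2 c cs t x
  set A := Afun κ μ 2 G c cs t x
  have hmain := weighted_abs_Dp_le hS (sumWeight_zero_le cs hμ) hc ht.le hκ1 hκ2
    (mul_nonneg hA hC₁pos.le) hK hx hus hu0 hu1
    (coneBound_of_Afun hG hκ1 hμ hc cs t x 0 (n := 0) (by norm_num) hbox)
    (coneBound_of_Afun hG hκ1 hμ hc cs t x 0 (n := 1) (by norm_num)
      (pt_eq_of_pos (hus.box c) hG hpos))
    (fun j => by
      have := pd_eq_of_nonneg hbox j
      fin_cases j
      exacts [coneBound_of_Afun hG hκ1 hμ hc cs t x 1 (n := 1) (by norm_num) this,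
        coneBound_of_Afun hG hκ1 hμ hc cs t x 2 (n := 1) (by norm_num) this,
        coneBound_of_Afun hG hκ1 hμ hc cs t x 3 (n := 1) (by norm_num) this])
    (fun j k hjk => by
      have := hrot j k
      fin_cases j <;> fin_cases k <;> first | exact absurd hjk (by decide) | skip
      exacts [coneBound_of_Afun hG hκ1 hμ hc cs t x 4 (n := 2) le_rfl this,
        coneBound_of_Afun hG hκ1 hμ hc cs t x 5 (n := 2) le_rfl this,
        coneBound_of_Afun hG hκ1 hμ hc cs t x 6 (n := 2) le_rfl this])
  have hr := norm_nonneg x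
  have hlog : 0 < Real.log (2 + t + ‖x‖) := Real.log_pos (by linarith)
  have hjb : jb (t + ‖x‖) ≤ (1 + c⁻¹) * (1 + (c * t + ‖x‖)) := by
    refine (jb_le_one_add_abs _).trans ?_
    rw [abs_of_nonneg (by positivity)]
    have : (1 + c⁻¹) * (1 + (c * t + ‖x‖)) =
        1 + t + ‖x‖ + (c⁻¹ + c⁻¹ * ‖x‖ + c * t) := by field_simp; ring
    have : 0 ≤ c⁻¹ + c⁻¹ * ‖x‖ + c * t := by positivity
    linarith
  have hj1 := (jb_pos ‖x‖).le
  have hj2 := (jb_pos (t + ‖x‖)).le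
  have hj3 := (jb_pos (c * t - ‖x‖)).le
  have hj4 : jb ‖x‖ ≤ 1 + ‖x‖ := by simpa using jb_le_one_add_abs ‖x‖
  rw [mul_right_comm, ← div_eq_mul_inv, div_le_iff₀ hlog]
  calc jb ‖x‖ * jb (t + ‖x‖) * jb (c * t - ‖x‖) ^ (κ - 1) * |Dp c u t x|
      ≤ (1 + ‖x‖) * ((1 + c⁻¹) * (1 + (c * t + ‖x‖))) * (1 + |c * t - ‖x‖|) ^ (κ - 1) *
        |Dp c u t x| := by
        have := Real.rpow_le_rpow hj3 (jb_le_one_add_abs (c * t - ‖x‖)) (by linarith : 0 ≤ κ - 1)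
        gcongr
    _ = (1 + c⁻¹) * ((1 + ‖x‖) * (1 + (c * t + ‖x‖)) * (1 + |c * t - ‖x‖|) ^ (κ - 1) *
        |Dp c u t x|) := by ring
    _ ≤ (1 + c⁻¹) * (C₀ * (A * C₁) * (C₂ * Real.log (2 + t + ‖x‖))) := by
        have := one_add_log_le hc ht.le hr
        refine mul_le_mul_of_nonneg_left (hmain.trans ?_) (by positivity)
        gcongr
    _ = _ := by ring

end PaperKatayama
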